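/- arXiv:math/0610592 — 3 statements merged into one kernel-verified Lean document; each statement's English description precedes it below -/
import Mathlib

section
/- For every k ≥ 0 there exists a unique monic polynomial p_{2k} of degree 2k such that ⟨p_{2k}, y^j⟩₁ = 0 for all 0 ≤ j ≤ 2k−1. -/
open MeasureTheory Polynomial

/-- The skew-inner product `⟨f,g⟩₁ = ∬ f(x) g(y) ε(x−y) e^{−V(x)−V(y)} dx dy`. -/
noncomputable def skewInner (V f g : Polynomial ℝ) : ℝ :=
  ∫ p : ℝ × ℝ, f.eval p.1 * g.eval p.2 * Real.sign (p.1 - p.2) *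
    Real.exp (-V.eval p.1 - V.eval p.2)


lemma mul_pos_of_ne {G : ℝ → ℝ} (hG : Continuous G) {x y : ℝ} (hxy : x ≤ y)
    (h : ∀ t, x ≤ t → t ≤ y → G t ≠ 0) : 0 < G x * G y := by
  by_contra hc
  push Not at hc
  have h0 : (0:ℝ) ∈ Set.uIcc (G x) (G y) := by
    rw [Set.mem_uIcc]
    rcases mul_nonpos_iff.1 hc with h | h
    · right; exact ⟨h.2, h.1⟩
    · left; exact h
  obtain ⟨t, ht, ht0⟩ := intermediate_value_uIcc (hG.continuousOn (s := Set.uIcc x y)) h0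
  rw [Set.uIcc_of_le hxy] at ht
  exact h t ht.1 ht.2 ht0

lemma sign_trans {s a b P : ℝ} (h1 : 0 < s * a * P) (h2 : 0 < a * b) : 0 < s * b * P := by
  have : 0 < (s * a * P) * (a * b) := mul_pos h1 h2
  have h3 : 0 < a ^ 2 * (s * b * P) := by nlinarith
  exact pos_of_mul_pos_right h3 (sq_nonneg a)

lemma sign_lemma (Z : Finset ℝ) : ∀ G : ℝ → ℝ, Continuous G → (∀ x, x ∉ Z → G x ≠ 0) →
    ∃ S ⊆ Z, ∃ σ : ℝ, σ ≠ 0 ∧ ∀ x, x ∉ Z → 0 < σ * G x * ∏ z ∈ S, (x - z) := by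
  induction Z using Finset.induction_on_max with
  | empty =>
    intro G hG h
    refine ⟨∅, le_rfl, G 0, h 0 (by simp), fun x _ => ?_⟩
    have : ∀ x, G x ≠ 0 := fun x => h x (by simp)
    rcases le_total 0 x with hx | hx
    · simpa using mul_pos_of_ne hG hx (fun t _ _ => this t)
    · simpa [mul_comm] using mul_pos_of_ne hG hx (fun t _ _ => this t)
  | insert z Z hz ih =>
    intro G hG h
    obtain ⟨t, htz, ht⟩ : ∃ t < z, ∀ w ∈ Z, w < t := by
      rcases Z.eq_empty_or_nonempty with rfl | hne
      · exact ⟨z - 1, by linarith, by simp⟩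
      · obtain ⟨t, h1, h2⟩ := exists_between (hz _ (Z.max'_mem hne))
        exact ⟨t, h2, fun w hw => lt_of_le_of_lt (Z.le_max' w hw) h1⟩
    have htZ : t ∉ Z := fun h => lt_irrefl _ (ht t h)
    have hzZ : z ∉ Z := fun h => lt_irrefl _ (hz z h)
    obtain ⟨S, hS, σ, hσ, hpos⟩ := ih (fun x => G (min x t)) (by fun_prop) (by
      intro x hx
      apply h
      rw [Finset.mem_insert, not_or]
      refine ⟨(lt_of_le_of_lt (min_le_right _ _) htz).ne, ?_⟩
      rcases min_choice x t with h | h <;> rw [h] <;> assumption)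
    have hleft : ∀ x, x ∉ Z → x < z → 0 < σ * G x * ∏ z ∈ S, (x - z) := by
      intro x hx hxz
      have h1 := hpos x hx
      rcases le_total x t with hxt | hxt
      · simpa [min_eq_left hxt] using h1
      · simp only [min_eq_right hxt] at h1
        refine sign_trans h1 (mul_pos_of_ne hG hxt fun u hu1 hu2 => h u ?_)
        rw [Finset.mem_insert, not_or]
        exact ⟨(hu2.trans_lt hxz).ne, fun hu => absurd (ht u hu) (not_lt.2 hu1)⟩
    have hnz : ∀ u, z < u → G u ≠ 0 := fun u hu => h u (by
      rw [Finset.mem_insert, not_or]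
      exact ⟨hu.ne', fun hh => absurd (hz u hh) (not_lt.2 hu.le)⟩)
    have hright : ∀ x, z < x → 0 < G (z+1) * G x := by
      intro x hx
      rcases le_total (z+1) x with h1 | h1
      · exact mul_pos_of_ne hG h1 fun u hu _ => hnz u (by linarith)
      · rw [mul_comm]; exact mul_pos_of_ne hG h1 fun u hu _ => hnz u (by linarith)
    have hb : G t ≠ 0 := h t (by
      rw [Finset.mem_insert, not_or]; exact ⟨htz.ne, htZ⟩)
    have hP : ∀ x, z < x → 0 < σ * G t * ∏ z ∈ S, (x - z) := by
      intro x hx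
      have := hpos x (fun hh => absurd (hz x hh) (not_lt.2 hx.le))
      simpa [min_eq_right (htz.trans hx).le] using this
    rcases lt_or_gt_of_ne (mul_ne_zero hb (hnz (z+1) (by linarith))) with hneg | hps
    · refine ⟨insert z S, Finset.insert_subset_insert _ hS, -σ, neg_ne_zero.2 hσ, fun x hx => ?_⟩
      rw [Finset.mem_insert, not_or] at hx
      rw [Finset.prod_insert (fun hh => hzZ (hS hh))]
      rcases lt_or_gt_of_ne hx.1 with hxz | hxz
      · have := mul_pos (hleft x hx.2 hxz) (sub_pos.2 hxz)
        linarith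
      · have h1 : 0 < (-σ) * (-G t) * ∏ z ∈ S, (x - z) := by have := hP x hxz; linarith
        have h2 := sign_trans h1 (b := G (z+1)) (by linarith)
        have h3 := sign_trans h2 (hright x hxz)
        have := mul_pos h3 (sub_pos.2 hxz)
        linarith
    · refine ⟨S, hS.trans (Finset.subset_insert _ _), σ, hσ, fun x hx => ?_⟩
      rw [Finset.mem_insert, not_or] at hx
      rcases lt_or_gt_of_ne hx.1 with hxz | hxz
      · exact hleft x hx.2 hxz
      · exact sign_trans (sign_trans (hP x hxz) hps) (hright x hxz)

lemma rolle_count {F F' : ℝ → ℝ} (hF : ∀ x, HasDerivAt F (F' x) x) (Z : Finset ℝ) :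
    (∀ z ∈ Z, F z = 0) → ∃ R : Finset ℝ, Z.card ≤ R.card + 1 ∧ (∀ r ∈ R, F' r = 0) ∧
      ∀ r ∈ R, ∃ z ∈ Z, r < z := by
  induction Z using Finset.induction_on_max with
  | empty => intro _; exact ⟨∅, by simp⟩
  | insert z Z hz ih =>
    intro h
    obtain ⟨R, hR1, hR2, hR3⟩ := ih (fun w hw => h w (Finset.mem_insert_of_mem hw))
    have hzZ : z ∉ Z := fun h => lt_irrefl _ (hz z h)
    rcases Z.eq_empty_or_nonempty with rfl | hne
    · exact ⟨∅, by simp⟩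
    · have hm := Z.max'_mem hne
      obtain ⟨r, hr, hr0⟩ := exists_hasDerivAt_eq_zero (hz _ hm)
        (fun x _ => (hF x).continuousAt.continuousWithinAt)
        (by rw [h _ (Finset.mem_insert_of_mem hm), h z (Finset.mem_insert_self _ _)])
        (fun x _ => hF x)
      have hrR : r ∉ R := by
        intro hh
        obtain ⟨w, hw, hw2⟩ := hR3 r hh
        have := Z.le_max' w hw
        linarith [hr.1]
      refine ⟨insert r R, ?_, ?_, ?_⟩
      · rw [Finset.card_insert_of_notMem hzZ, Finset.card_insert_of_notMem hrR]; omega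
      · intro s hs
        rcases Finset.mem_insert.1 hs with rfl | hs
        · exact hr0
        · exact hR2 s hs
      · intro s hs
        rcases Finset.mem_insert.1 hs with rfl | hs
        · exact ⟨z, Finset.mem_insert_self _ _, hr.2⟩
        · obtain ⟨w, hw, hw2⟩ := hR3 s hs
          exact ⟨w, Finset.mem_insert_of_mem hw, hw2⟩

lemma rolle_inf {F F' : ℝ → ℝ} (hF : ∀ x, HasDerivAt F (F' x) x) {m : ℝ} (hm : F m = 0)
    (hlim : Filter.Tendsto F Filter.atTop (nhds 0)) : ∃ r, m < r ∧ F' r = 0 := by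
  have hc : Continuous F := continuous_iff_continuousAt.2 fun x => (hF x).continuousAt
  by_contra hcon
  push Not at hcon
  have hinj : ∀ x y, m ≤ x → x < y → F x ≠ F y := by
    intro x y hx hxy he
    obtain ⟨r, hr, hr0⟩ := exists_hasDerivAt_eq_zero hxy hc.continuousOn he (fun x _ => hF x)
    exact hcon r (hx.trans_lt hr.1) hr0
  have ha : F (m+1) ≠ 0 := by rw [← hm]; exact (hinj m (m+1) le_rfl (by linarith)).symm
  -- a point `y` beyond `m+1` with `|F y| < |F (m+1)|`
  obtain ⟨y, hy1, hy2⟩ := ((hlim.abs.eventually (gt_mem_nhds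
    (by simpa using ha : |(0:ℝ)| < |F (m+1)|))).and (Filter.eventually_gt_atTop (m+1))).exists
  have key : F y ∈ Set.uIcc (F m) (F (m+1)) ∨ F m ∈ Set.uIcc (F (m+1)) (F y) := by
    rw [hm, Set.mem_uIcc, Set.mem_uIcc]
    grind
  rcases key with h | h
  · obtain ⟨t, ht, ht0⟩ := intermediate_value_uIcc (hc.continuousOn (s := Set.uIcc m (m+1))) h
    rw [Set.uIcc_of_le (by linarith)] at ht
    exact hinj t y ht.1 (by linarith [ht.2]) ht0
  · obtain ⟨t, ht, ht0⟩ := intermediate_value_uIcc (hc.continuousOn (s := Set.uIcc (m+1) y)) h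
    rw [Set.uIcc_of_le hy2.le] at ht
    exact hinj m t le_rfl (by linarith [ht.1]) ht0.symm

lemma int_half (V : ℝ[X]) (hdeg : 2 ≤ V.natDegree) (hlc : 0 < V.leadingCoeff) (p : ℝ[X]) :
    IntegrableOn (fun x => p.eval x * Real.exp (-V.eval x)) (Set.Ioi 0) := by
  apply integrable_of_isBigO_exp_neg (b := 1) one_pos (by fun_prop)
  have hd : (C 2 * X : ℝ[X]).degree < V.degree := by
    rw [Polynomial.degree_eq_natDegree (p := V) (by rintro rfl; simp at hlc)]
    refine lt_of_le_of_lt (Polynomial.degree_C_mul_X_le 2) ?_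
    exact_mod_cast hdeg
  have h1 : Filter.Tendsto (fun x => (V - C 2 * X).eval x) Filter.atTop Filter.atTop := by
    apply Polynomial.tendsto_atTop_of_leadingCoeff_nonneg
    · rw [Polynomial.degree_sub_eq_left_of_degree_lt hd]
      exact Polynomial.natDegree_pos_iff_degree_pos.1 (by omega)
    · rw [Polynomial.leadingCoeff_sub_of_degree_lt hd]; exact hlc.le
  have h2 := (Polynomial.tendsto_div_exp_atTop p).mul
    (Real.tendsto_exp_neg_atTop_nhds_zero.comp h1)
  have h3 := (h2.isBigO_one ℝ).mul (Asymptotics.isBigO_refl (fun x => Real.exp (-1 * x)) Filter.atTop)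
  refine (h3.congr_left fun x => ?_).congr_right fun x => by simp
  simp only [Function.comp, div_eq_mul_inv, ← Real.exp_neg, mul_assoc, ← Real.exp_add]
  congr 2
  simp
  ring

lemma int_poly (V : ℝ[X]) (hEven : Even V.natDegree) (hdeg : 2 ≤ V.natDegree)
    (hlc : 0 < V.leadingCoeff) (p : ℝ[X]) :
    Integrable (fun x => p.eval x * Real.exp (-V.eval x)) := by
  have h1 := int_half V hdeg hlc p
  have hn : (V.comp (-X)).natDegree = V.natDegree := by
    rw [Polynomial.natDegree_comp]; simp
  have h2 := int_half (V.comp (-X)) (by rw [hn]; exact hdeg) (by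
    rw [Polynomial.leadingCoeff_comp (by simp)]; simpa [hEven.neg_one_pow] using hlc) (p.comp (-X))
  have h3 := h2.comp_neg
  simp only [Polynomial.eval_comp, Polynomial.eval_neg, Polynomial.eval_X, neg_neg, Set.neg_Ioi,
    neg_zero] at h3
  rw [← integrableOn_univ, ← Set.Iic_union_Ioi (a := (0:ℝ))]
  exact ((integrableOn_Iic_iff_integrableOn_Iio enorm_ne_top).2 h3).union h1

lemma meas_sign : Measurable Real.sign := by
  unfold Real.sign
  exact Measurable.ite measurableSet_Iio measurable_const
    (Measurable.ite measurableSet_Ioi measurable_const measurable_const)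

lemma abs_sign_le (x : ℝ) : ‖Real.sign x‖ ≤ 1 := by
  rcases Real.sign_apply_eq x with h | h | h <;> simp [h]

lemma int_kernel (V : ℝ[X]) (hEven : Even V.natDegree) (hdeg : 2 ≤ V.natDegree)
    (hlc : 0 < V.leadingCoeff) (f g : ℝ[X]) :
    Integrable (fun p : ℝ × ℝ => f.eval p.1 * g.eval p.2 * Real.sign (p.1 - p.2) *
      Real.exp (-V.eval p.1 - V.eval p.2)) := by
  have h := ((int_poly V hEven hdeg hlc f).mul_prod (int_poly V hEven hdeg hlc g)).bdd_mul
    (f := fun p : ℝ × ℝ => Real.sign (p.1 - p.2)) (c := 1)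
    (meas_sign.comp (measurable_fst.sub measurable_snd)).aestronglyMeasurable
    (Filter.Eventually.of_forall fun p => abs_sign_le _)
  refine h.congr (Filter.Eventually.of_forall fun p => ?_)
  simp only [sub_eq_add_neg, Real.exp_add]
  ring

noncomputable def skewF (V q : ℝ[X]) (y : ℝ) : ℝ :=
  ∫ x, q.eval x * Real.exp (-V.eval x) * Real.sign (x - y)

lemma kernel_inner (V f g : ℝ[X]) (y : ℝ) :
    ∫ x, f.eval x * g.eval y * Real.sign (x - y) * Real.exp (-V.eval x - V.eval y)
      = g.eval y * Real.exp (-V.eval y) * skewF V f y := by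
  rw [skewF, ← integral_const_mul]
  congr 1
  ext x
  simp only [sub_eq_add_neg, Real.exp_add]
  ring

lemma int_F (V : ℝ[X]) (hEven : Even V.natDegree) (hdeg : 2 ≤ V.natDegree)
    (hlc : 0 < V.leadingCoeff) (f g : ℝ[X]) :
    Integrable (fun y => g.eval y * Real.exp (-V.eval y) * skewF V f y) := by
  have := (int_kernel V hEven hdeg hlc f g).integral_prod_right
  simpa only [kernel_inner] using this

lemma skew_eq (V : ℝ[X]) (hEven : Even V.natDegree) (hdeg : 2 ≤ V.natDegree)
    (hlc : 0 < V.leadingCoeff) (f g : ℝ[X]) :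
    skewInner V f g = ∫ y, g.eval y * Real.exp (-V.eval y) * skewF V f y := by
  unfold skewInner
  rw [Measure.volume_eq_prod, integral_prod_symm _ (int_kernel V hEven hdeg hlc f g)]
  simp only [kernel_inner]

lemma skewF_eq (V : ℝ[X]) (hEven : Even V.natDegree) (hdeg : 2 ≤ V.natDegree)
    (hlc : 0 < V.leadingCoeff) (q : ℝ[X]) (y : ℝ) :
    skewF V q y = (∫ x in Set.Ioi 0, q.eval x * Real.exp (-V.eval x))
      - (∫ x in Set.Iic 0, q.eval x * Real.exp (-V.eval x))
      - 2 * ∫ x in (0:ℝ)..y, q.eval x * Real.exp (-V.eval x) := by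
  have hi := int_poly V hEven hdeg hlc q
  have hs : Integrable (fun x => q.eval x * Real.exp (-V.eval x) * Real.sign (x - y)) := by
    have := hi.bdd_mul (f := fun x => Real.sign (x - y)) (c := 1)
      (meas_sign.comp (measurable_id.sub_const y)).aestronglyMeasurable
      (Filter.Eventually.of_forall fun p => abs_sign_le _)
    simpa only [mul_comm] using this
  have e1 : ∫ x in Set.Iic y, q.eval x * Real.exp (-V.eval x) * Real.sign (x - y)
      = - ∫ x in Set.Iic y, q.eval x * Real.exp (-V.eval x) := by
    rw [← integral_neg, integral_Iic_eq_integral_Iio, integral_Iic_eq_integral_Iio]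
    refine setIntegral_congr_fun measurableSet_Iio fun x hx => ?_
    simp only [Real.sign_of_neg (sub_neg.2 hx)]; ring
  have e2 : ∫ x in Set.Ioi y, q.eval x * Real.exp (-V.eval x) * Real.sign (x - y)
      = ∫ x in Set.Ioi y, q.eval x * Real.exp (-V.eval x) := by
    refine setIntegral_congr_fun measurableSet_Ioi fun x hx => ?_
    simp only [Real.sign_of_pos (sub_pos.2 hx)]; ring
  have e3 := intervalIntegral.integral_Iic_add_Ioi (b := y) hs.integrableOn hs.integrableOn
  have e4 := intervalIntegral.integral_Iic_add_Ioi (b := y) hi.integrableOn hi.integrableOn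
  have e5 := intervalIntegral.integral_Iic_add_Ioi (b := (0:ℝ)) hi.integrableOn hi.integrableOn
  have e6 := intervalIntegral.integral_Iic_sub_Iic (a := 0) (b := y) hi.integrableOn hi.integrableOn
  unfold skewF
  linarith

lemma skewF_deriv (V : ℝ[X]) (hEven : Even V.natDegree) (hdeg : 2 ≤ V.natDegree)
    (hlc : 0 < V.leadingCoeff) (q : ℝ[X]) (y : ℝ) :
    HasDerivAt (skewF V q) (-(2 * (q.eval y * Real.exp (-V.eval y)))) y := by
  rw [funext (skewF_eq V hEven hdeg hlc q)]
  have hc : Continuous (fun x => q.eval x * Real.exp (-V.eval x)) := by fun_prop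
  exact ((hc.integral_hasStrictDerivAt 0 y).hasDerivAt.const_mul 2).const_sub _

lemma skewF_top (V : ℝ[X]) (hEven : Even V.natDegree) (hdeg : 2 ≤ V.natDegree)
    (hlc : 0 < V.leadingCoeff) (q : ℝ[X]) :
    Filter.Tendsto (skewF V q) Filter.atTop (nhds (-∫ x, q.eval x * Real.exp (-V.eval x))) := by
  have hi := int_poly V hEven hdeg hlc q
  have e5 := intervalIntegral.integral_Iic_add_Ioi (b := (0:ℝ)) hi.integrableOn hi.integrableOn
  rw [funext (skewF_eq V hEven hdeg hlc q)]
  have := ((intervalIntegral_tendsto_integral_Ioi 0 hi.integrableOn Filter.tendsto_id).const_mul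
    2).const_sub ((∫ x in Set.Ioi 0, q.eval x * Real.exp (-V.eval x))
      - (∫ x in Set.Iic 0, q.eval x * Real.exp (-V.eval x)))
  simp only [id] at this
  convert this using 2
  linarith

lemma skewF_bot (V : ℝ[X]) (hEven : Even V.natDegree) (hdeg : 2 ≤ V.natDegree)
    (hlc : 0 < V.leadingCoeff) (q : ℝ[X]) :
    Filter.Tendsto (skewF V q) Filter.atBot (nhds (∫ x, q.eval x * Real.exp (-V.eval x))) := by
  have hi := int_poly V hEven hdeg hlc q
  have e5 := intervalIntegral.integral_Iic_add_Ioi (b := (0:ℝ)) hi.integrableOn hi.integrableOn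
  rw [funext (skewF_eq V hEven hdeg hlc q)]
  simp only [intervalIntegral.integral_symm _ (0:ℝ)]
  have := ((intervalIntegral_tendsto_integral_Iic 0 hi.integrableOn Filter.tendsto_id).neg.const_mul
    2).const_sub ((∫ x in Set.Ioi 0, q.eval x * Real.exp (-V.eval x))
      - (∫ x in Set.Iic 0, q.eval x * Real.exp (-V.eval x)))
  simp only [id] at this
  convert this using 2
  linarith

lemma core (V : ℝ[X]) (hEven : Even V.natDegree) (hdeg : 2 ≤ V.natDegree)
    (hlc : 0 < V.leadingCoeff) (k : ℕ) (q : ℝ[X]) (hq : q.degree < (2 * k : ℕ))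
    (h : ∀ j < 2 * k, skewInner V q (X ^ j) = 0) : q = 0 := by
  by_contra hq0
  have hnd : q.natDegree < 2 * k := (Polynomial.natDegree_lt_iff_degree_lt hq0).2 hq
  have hD := skewF_deriv V hEven hdeg hlc q
  have hcont : Continuous (skewF V q) :=
    continuous_iff_continuousAt.2 fun x => (hD x).continuousAt
  have hroots : ∀ R : Finset ℝ,
      (∀ r ∈ R, -(2 * (q.eval r * Real.exp (-V.eval r))) = 0) → R.card < 2 * k := by
    intro R hR
    refine lt_of_le_of_lt ?_ hnd
    refine Polynomial.card_le_degree_of_subset_roots (p := q) fun r hr => ?_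
    rw [Polynomial.mem_roots hq0, Polynomial.IsRoot]
    have := hR r hr
    simpa [Real.exp_ne_zero] using this
  have hzeros : ∀ Z : Finset ℝ, (∀ z ∈ Z, skewF V q z = 0) → Z.card ≤ 2 * k := by
    intro Z hZ
    obtain ⟨R, hR1, hR2, -⟩ := rolle_count hD Z hZ
    have := hroots R hR2
    omega
  have hfin : {z | skewF V q z = 0}.Finite := by
    by_contra hinf
    obtain ⟨Z, hZ, hc⟩ := Set.Infinite.exists_subset_card_eq hinf (2 * k + 1)
    have := hzeros Z (fun z hz => hZ hz)
    omega
  set Z := hfin.toFinset with hZdef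
  have hZ : ∀ z, z ∈ Z ↔ skewF V q z = 0 := fun z => by simp [hZdef]
  have hZc := hzeros Z (fun z hz => (hZ z).1 hz)
  obtain ⟨S, hS, σ, hσ, hpos⟩ := sign_lemma Z (skewF V q) hcont (fun x hx hx0 => hx ((hZ x).2 hx0))
  obtain ⟨x0, hx0⟩ := Infinite.exists_notMem_finset Z
  have hScard : 2 * k ≤ S.card := by
    by_contra hlt
    push Not at hlt
    set s : ℝ[X] := ∏ z ∈ S, (X - C z) with hs
    have hsd : s.natDegree < 2 * k := by
      rw [hs, Polynomial.natDegree_prod_of_monic _ _ (fun z _ => monic_X_sub_C z)]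
      simpa using hlt
    have hse : ∀ x, s.eval x = ∏ z ∈ S, (x - z) := by
      intro x; simp [hs, Polynomial.eval_prod]
    have h0 : ∫ y, s.eval y * Real.exp (-V.eval y) * skewF V q y = 0 := by
      have : ∀ y, s.eval y * Real.exp (-V.eval y) * skewF V q y =
          ∑ i ∈ Finset.range (2 * k), s.coeff i *
            ((X ^ i : ℝ[X]).eval y * Real.exp (-V.eval y) * skewF V q y) := by
        intro y
        rw [Polynomial.eval_eq_sum_range' hsd, Finset.sum_mul, Finset.sum_mul]
        refine Finset.sum_congr rfl fun i _ => ?_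
        simp; ring
      simp only [this]
      rw [integral_finsetSum _ fun i _ => (int_F V hEven hdeg hlc q _).const_mul _]
      refine Finset.sum_eq_zero fun i hi => ?_
      rw [integral_const_mul, ← skew_eq V hEven hdeg hlc, h i (Finset.mem_range.1 hi), mul_zero]
    have hnn : ∀ y, 0 ≤ σ * (s.eval y * Real.exp (-V.eval y) * skewF V q y) := by
      intro y
      by_cases hy : y ∈ Z
      · rw [(hZ y).1 hy]; simp
      · have := mul_pos (hpos y hy) (Real.exp_pos (-V.eval y))
        rw [hse]
        linarith
    have h1 : ∫ y, σ * (s.eval y * Real.exp (-V.eval y) * skewF V q y) = 0 := by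
      rw [integral_const_mul, h0, mul_zero]
    rw [integral_eq_zero_iff_of_nonneg hnn ((int_F V hEven hdeg hlc q s).const_mul σ),
      Continuous.ae_eq_iff_eq _ (by fun_prop) continuous_zero] at h1
    have h2 := congrFun h1 x0
    have := mul_pos (hpos x0 hx0) (Real.exp_pos (-V.eval x0))
    rw [← hse] at this
    simp only [Pi.zero_apply] at h2
    linarith
  have hSZ : S = Z := Finset.eq_of_subset_of_card_le hS (by omega)
  clear_value Z
  subst hSZ
  have hcard : S.card = 2 * k := by omega
  have hne : S.Nonempty := Finset.card_pos.1 (by omega)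
  have hmax : ∀ z ∈ S, z ≤ S.max' hne := fun z hz => S.le_max' z hz
  have htop : ∀ᶠ x in Filter.atTop, 0 ≤ σ * skewF V q x := by
    filter_upwards [Filter.eventually_gt_atTop (S.max' hne)] with x hx
    have hx1 : x ∉ S := fun hh => absurd (hmax x hh) (not_le.2 hx)
    exact (pos_of_mul_pos_left (hpos x hx1)
      (Finset.prod_nonneg fun z hz => by linarith [hmax z hz])).le
  have hbot : ∀ᶠ x in Filter.atBot, 0 ≤ σ * skewF V q x := by
    filter_upwards [Filter.eventually_lt_atBot (S.min' hne)] with x hx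
    have hmin : ∀ z ∈ S, S.min' hne ≤ z := fun z hz => S.min'_le z hz
    have hx1 : x ∉ S := fun hh => absurd (hmin x hh) (not_le.2 hx)
    refine (pos_of_mul_pos_left (hpos x hx1) ?_).le
    have : ∏ z ∈ S, (x - z) = ∏ z ∈ S, (z - x) := by
      rw [Finset.prod_congr rfl (fun z _ => (neg_sub z x).symm), Finset.prod_neg, hcard]
      simp
    rw [this]
    exact Finset.prod_nonneg fun z hz => by linarith [hmin z hz]
  have l1 := ge_of_tendsto ((skewF_top V hEven hdeg hlc q).const_mul σ) htop
  have l2 := ge_of_tendsto ((skewF_bot V hEven hdeg hlc q).const_mul σ) hbot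
  have hc0 : ∫ x, q.eval x * Real.exp (-V.eval x) = 0 := by
    have : σ * ∫ x, q.eval x * Real.exp (-V.eval x) = 0 := by linarith
    exact (mul_eq_zero.1 this).resolve_left hσ
  have hlim := skewF_top V hEven hdeg hlc q
  rw [hc0, neg_zero] at hlim
  obtain ⟨r, hr, hr0⟩ := rolle_inf hD ((hZ _).1 (S.max'_mem hne)) hlim
  obtain ⟨R, hR1, hR2, hR3⟩ := rolle_count hD S (fun z hz => (hZ z).1 hz)
  have hrR : r ∉ R := by
    intro hh
    obtain ⟨w, hw, hw2⟩ := hR3 r hh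
    linarith [hmax w hw]
  have := hroots (insert r R) (by
    intro u hu
    rcases Finset.mem_insert.1 hu with rfl | hu
    · exact hr0
    · exact hR2 u hu)
  rw [Finset.card_insert_of_notMem hrR] at this
  omega

lemma skew_add (V : ℝ[X]) (hEven : Even V.natDegree) (hdeg : 2 ≤ V.natDegree)
    (hlc : 0 < V.leadingCoeff) (f f' g : ℝ[X]) :
    skewInner V (f + f') g = skewInner V f g + skewInner V f' g := by
  unfold skewInner
  rw [← integral_add (int_kernel V hEven hdeg hlc f g) (int_kernel V hEven hdeg hlc f' g)]
  congr 1; ext p; simp; ring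

lemma skew_smul (V : ℝ[X]) (c : ℝ) (f g : ℝ[X]) :
    skewInner V (c • f) g = c * skewInner V f g := by
  unfold skewInner
  rw [← integral_const_mul]
  congr 1; ext p; simp; ring

/-- For every `k ≥ 0` there is a unique monic polynomial `p_{2k}` of degree `2k` with
`⟨p_{2k}, y^j⟩₁ = 0` for all `0 ≤ j ≤ 2k − 1`. -/
theorem skew_orthogonal_even_exists_unique
    (V : Polynomial ℝ) (hEven : Even V.natDegree) (hdeg : 2 ≤ V.natDegree)
    (hlc : 0 < V.leadingCoeff) (k : ℕ) :
    ∃! p : Polynomial ℝ, p.Monic ∧ p.natDegree = 2 * k ∧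
      ∀ j < 2 * k, skewInner V p (X ^ j) = 0 := by
  let T : Polynomial.degreeLT ℝ (2 * k) →ₗ[ℝ] (Fin (2 * k) → ℝ) :=
    { toFun := fun q j => skewInner V q.1 (X ^ (j : ℕ))
      map_add' := fun a b => by
        ext j; exact skew_add V hEven hdeg hlc _ _ _
      map_smul' := fun c a => by
        ext j; exact skew_smul V c _ _ }
  have hinj : Function.Injective T := by
    rw [injective_iff_map_eq_zero]
    intro q hq
    apply Subtype.ext
    exact core V hEven hdeg hlc k q.1 (Polynomial.mem_degreeLT.1 q.2)
      (fun j hj => congrFun hq ⟨j, hj⟩)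
  have hsurj : Function.Surjective T := by
    have e := Polynomial.degreeLTEquiv ℝ (2 * k)
    have : FiniteDimensional ℝ (Polynomial.degreeLT ℝ (2 * k)) := e.symm.finiteDimensional
    exact (LinearMap.injective_iff_surjective_of_finrank_eq_finrank e.finrank_eq).1 hinj
  obtain ⟨q, hq⟩ := hsurj (fun j => - skewInner V (X ^ (2 * k)) (X ^ (j : ℕ)))
  have hqd := Polynomial.mem_degreeLT.1 q.2
  refine ⟨X ^ (2 * k) + q.1, ⟨Polynomial.monic_X_pow_add hqd, ?_, ?_⟩, ?_⟩
  · exact Polynomial.natDegree_eq_of_degree_eq_some (by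
      rw [Polynomial.degree_add_eq_left_of_degree_lt (by simpa using hqd), Polynomial.degree_X_pow])
  · intro j hj
    rw [skew_add V hEven hdeg hlc]
    have := congrFun hq ⟨j, hj⟩
    simp only [T, LinearMap.coe_mk, AddHom.coe_mk] at this
    rw [this]; ring
  · rintro p ⟨hm, hd, hp⟩
    have hpd : p.degree = ((2 * k : ℕ) : WithBot ℕ) := by rw [Polynomial.degree_eq_natDegree hm.ne_zero, hd]
    have hlt : (p - X ^ (2 * k)).degree < ((2 * k : ℕ) : WithBot ℕ) := by
      rw [← hpd]
      exact Polynomial.degree_sub_lt_left (by rw [hpd, Polynomial.degree_X_pow]) hm.ne_zero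
        (by simp [hm.leadingCoeff])
    have hz := core V hEven hdeg hlc k ((p - X ^ (2 * k)) + (-1 : ℝ) • q.1)
      (lt_of_le_of_lt (Polynomial.degree_add_le _ _) (max_lt hlt (by simpa using hqd))) (by
        intro j hj
        have e := congrFun hq ⟨j, hj⟩
        simp only [T, LinearMap.coe_mk, AddHom.coe_mk] at e
        have : p - X ^ (2 * k) + (-1 : ℝ) • q.1 = p + ((-1 : ℝ) • X ^ (2 * k) + (-1 : ℝ) • q.1) := by
          simp only [neg_smul, one_smul]; ring
        rw [this, skew_add V hEven hdeg hlc, skew_add V hEven hdeg hlc, skew_smul, skew_smul,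
          hp j hj, e]
        ring)
    simp only [neg_smul, one_smul] at hz
    linear_combination hz
end

section
/- For every k ≥ 0 there exists a unique monic polynomial p_{2k+1} of degree 2k+1 whose coefficient of x^{2k} vanishes and such that ⟨p_{2k+1}, y^j⟩₁ = 0 for all 0 ≤ j ≤ 2k−1. -/
open MeasureTheory Polynomial

namespace SkewAux
open Filter Topology

lemma integrableOn_Ioi (V f : Polynomial ℝ) (hdeg : 2 ≤ V.natDegree)
    (hlc : 0 < V.leadingCoeff) :
    IntegrableOn (fun x => f.eval x * Real.exp (-V.eval x)) (Set.Ioi 0) := by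
  apply integrable_of_isBigO_exp_neg (b := 1) one_pos
  · fun_prop
  · have hd : ((C 2 * X : ℝ[X])).natDegree < V.natDegree := by
      have : ((C 2 * X : ℝ[X])).natDegree ≤ 1 := (natDegree_C_mul_le _ _).trans natDegree_X_le
      omega
    have h1 : Tendsto (fun x => (V - C 2 * X).eval x) atTop atTop := by
      apply Polynomial.tendsto_atTop_of_leadingCoeff_nonneg
      · rw [degree_sub_eq_left_of_degree_lt (degree_lt_degree hd)]
        exact natDegree_pos_iff_degree_pos.mp (by omega)
      · rw [leadingCoeff_sub_of_degree_lt (degree_lt_degree hd)]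
        exact hlc.le
    have h2 : Tendsto (fun x => Real.exp (-(V - C 2 * X).eval x)) atTop (𝓝 0) :=
      Real.tendsto_exp_neg_atTop_nhds_zero.comp h1
    have h3 := (Polynomial.tendsto_div_exp_atTop f).mul h2
    have h4 := (h3.isBigO_one ℝ).mul (Asymptotics.isBigO_refl (fun x : ℝ => Real.exp (-1 * x)) atTop)
    refine (h4.congr_left ?_).congr_right ?_
    · intro x
      simp only [eval_sub, eval_mul, eval_C, eval_X]
      rw [div_eq_mul_inv, ← Real.exp_neg, mul_assoc, mul_assoc, ← Real.exp_add, ← Real.exp_add]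
      ring_nf
    · intro x; simp

lemma integrable_w (V f : Polynomial ℝ) (hEven : Even V.natDegree) (hdeg : 2 ≤ V.natDegree)
    (hlc : 0 < V.leadingCoeff) :
    Integrable (fun x => f.eval x * Real.exp (-V.eval x)) := by
  rw [← integrableOn_univ, ← Set.Iic_union_Ioi (a := (0:ℝ))]
  refine IntegrableOn.union ?_ (integrableOn_Ioi V f hdeg hlc)
  have h := integrableOn_Ioi (V.comp (-X)) (f.comp (-X)) (by simpa [natDegree_comp] using hdeg)
    (by rw [leadingCoeff_comp (by simp)]; simpa [hEven.neg_one_pow] using hlc)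
  rw [integrableOn_Iic_iff_integrableOn_Iio]
  have h2 := (MeasurePreserving.integrableOn_comp_preimage (Measure.measurePreserving_neg (volume : Measure ℝ))
    (Homeomorph.neg ℝ).measurableEmbedding (f := fun x => f.eval x * Real.exp (-V.eval x))
    (s := Set.Iio 0)).1
  apply h2
  have e : (Neg.neg ⁻¹' Set.Iio (0:ℝ)) = Set.Ioi 0 := by ext x; simp
  rw [e]
  refine h.congr_fun (fun x _ => ?_) measurableSet_Ioi
  simp

lemma measurable_sign : Measurable Real.sign := by
  have : Real.sign = fun r : ℝ => if r < 0 then -1 else if 0 < r then 1 else 0 := by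
    ext r; rfl
  rw [this]
  exact Measurable.ite measurableSet_Iio measurable_const
    (Measurable.ite measurableSet_Ioi measurable_const measurable_const)

lemma integrable_prod (V f g : Polynomial ℝ) (hEven : Even V.natDegree) (hdeg : 2 ≤ V.natDegree)
    (hlc : 0 < V.leadingCoeff) :
    Integrable (fun p : ℝ × ℝ => f.eval p.1 * g.eval p.2 * Real.sign (p.1 - p.2) *
      Real.exp (-V.eval p.1 - V.eval p.2)) := by
  have h := (integrable_w V f hEven hdeg hlc).mul_prod (integrable_w V g hEven hdeg hlc)
  have h2 := h.bdd_mul (f := fun p : ℝ × ℝ => Real.sign (p.1 - p.2)) (c := 1)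
    (measurable_sign.comp (measurable_fst.sub measurable_snd)).aestronglyMeasurable
    (by
      refine Eventually.of_forall fun p => ?_
      rcases Real.sign_apply_eq (p.1 - p.2) with h | h | h <;> simp [h])
  refine h2.congr (Eventually.of_forall fun p => ?_)
  simp only [sub_eq_add_neg, Real.exp_add]
  ring

/-- sign flips -/
lemma sc (Z0 : Set ℝ) (Z : Finset ℝ) : ∀ G : ℝ → ℝ, (∀ x ∉ Z0, G x ≠ 0) → (↑Z ⊆ Z0) →
    (∀ x y, x < y → x ∉ Z0 → y ∉ Z0 → (∀ z ∈ Z, ¬ (x < z ∧ z < y)) → 0 < G x * G y) →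
    ∃ S ⊆ Z, ∀ x y, x < y → x ∉ Z0 → y ∉ Z0 →
      0 < (G x * ∏ z ∈ S, (x - z)) * (G y * ∏ z ∈ S, (y - z)) := by
  induction Z using Finset.induction_on with
  | empty =>
    intro G _ _ h
    exact ⟨∅, by simp, fun x y hxy hx hy => by simpa using h x y hxy hx hy (by simp)⟩
  | insert a Z haZ ih =>
    intro G hG hZ h
    have ha : a ∈ Z0 := hZ (by simp)
    have hZ' : (↑Z : Set ℝ) ⊆ Z0 := fun z hz => hZ (by simp at hz; simp [hz])
    by_cases hc : ∃ x y, x < a ∧ a < y ∧ x ∉ Z0 ∧ y ∉ Z0 ∧ (∀ z ∈ Z, ¬ (x < z ∧ z < y)) ∧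
        G x * G y < 0
    · obtain ⟨x, y, hxa, hay, hx, hy, hz, hneg⟩ := hc
      obtain ⟨S, hS, hS2⟩ := ih (fun t => G t * (t - a)) (fun t ht =>
        mul_ne_zero (hG t ht) (sub_ne_zero.2 (fun e => ht (e ▸ ha)))) hZ' (by
          intro x' y' hxy' hx' hy' hz'
          have hx'a : x' ≠ a := fun e => hx' (e ▸ ha)
          have hy'a : y' ≠ a := fun e => hy' (e ▸ ha)
          have key : (x' < a ∧ a < y') ∨ ((y' < a) ∨ (a < x')) := by
            rcases lt_or_gt_of_ne hx'a with h1 | h1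
            · rcases lt_or_gt_of_ne hy'a with h2 | h2
              · right; left; exact h2
              · left; exact ⟨h1, h2⟩
            · right; right; exact h1
          rcases key with ⟨h1, h2⟩ | h1
          · have same : ∀ u v, u ∉ Z0 → v ∉ Z0 → (∀ z ∈ insert a Z, ¬ (u < z ∧ z < v)) →
                (∀ z ∈ insert a Z, ¬ (v < z ∧ z < u)) → 0 < G u * G v := by
              intro u v hu hv huv hvu
              rcases lt_trichotomy u v with hh | hh | hh
              · exact h u v hh hu hv huv
              · subst hh; exact mul_self_pos.2 (hG u hu)
              · rw [mul_comm]; exact h v u hh hv hu hvu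
            have e1 : 0 < G x * G x' := by
              apply same x x' hx hx'
              · intro z hzz ⟨p, q⟩
                rcases Finset.mem_insert.1 hzz with rfl | hzz
                · linarith
                · exact hz z hzz ⟨p, by linarith⟩
              · intro z hzz ⟨p, q⟩
                rcases Finset.mem_insert.1 hzz with rfl | hzz
                · linarith
                · exact hz' z hzz ⟨p, by linarith⟩
            have e2 : 0 < G y * G y' := by
              apply same y y' hy hy'
              · intro z hzz ⟨p, q⟩
                rcases Finset.mem_insert.1 hzz with rfl | hzz
                · linarith
                · exact hz' z hzz ⟨by linarith, q⟩
              · intro z hzz ⟨p, q⟩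
                rcases Finset.mem_insert.1 hzz with rfl | hzz
                · linarith
                · exact hz z hzz ⟨by linarith, q⟩
            have e3 : G x' * G y' < 0 := by
              have e4 := mul_pos e1 e2
              by_contra hcon
              push Not at hcon
              have : (G x * G y) * (G x' * G y') ≤ 0 :=
                mul_nonpos_of_nonpos_of_nonneg hneg.le hcon
              nlinarith
            have e5 : (x' - a) * (y' - a) < 0 :=
              mul_neg_of_neg_of_pos (by linarith) (by linarith)
            have := mul_pos_of_neg_of_neg e3 e5
            linarith [this]
          · have e3 : 0 < G x' * G y' := by
              apply h x' y' hxy' hx' hy'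
              intro z hzz ⟨p, q⟩
              rcases Finset.mem_insert.1 hzz with rfl | hzz
              · rcases h1 with h1 | h1 <;> linarith
              · exact hz' z hzz ⟨p, q⟩
            have e5 : 0 < (x' - a) * (y' - a) := by
              rcases h1 with h1 | h1
              · exact mul_pos_of_neg_of_neg (by linarith) (by linarith)
              · exact mul_pos (by linarith) (by linarith)
            have := mul_pos e3 e5
            linarith [this])
      refine ⟨insert a S, Finset.insert_subset_insert _ hS, fun x y hxy hx hy => ?_⟩
      have haS : a ∉ S := fun hh => haZ (hS hh)
      rw [Finset.prod_insert haS, Finset.prod_insert haS]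
      have := hS2 x y hxy hx hy
      simpa only [mul_assoc] using this
    · push Not at hc
      obtain ⟨S, hS, hS2⟩ := ih G hG hZ' (by
        intro x y hxy hx hy hz
        by_cases hh : x < a ∧ a < y
        · exact lt_of_le_of_ne (hc x y hh.1 hh.2 hx hy (fun z hz1 hz2 => not_lt.1 fun h3 => hz z hz1 ⟨hz2, h3⟩))
            (mul_ne_zero (hG x hx) (hG y hy)).symm
        · apply h x y hxy hx hy
          intro z hzz
          rcases Finset.mem_insert.1 hzz with rfl | hzz
          · exact hh
          · exact hz z hzz)
      exact ⟨S, hS.trans (Finset.subset_insert _ _), hS2⟩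

lemma rolle_count (G G' : ℝ → ℝ) (hG : ∀ x, HasDerivAt G (G' x) x) (R : Finset ℝ)
    (hR : ∀ x, G' x = 0 → x ∈ R) (Z : Finset ℝ) (hZ : ∀ z ∈ Z, G z = 0) :
    Z.card ≤ (R.filter (fun r => ∃ z ∈ Z, r < z)).card + 1 := by
  induction Z using Finset.induction_on_max with
  | empty => simp
  | insert a Z hmax ih =>
    have haZ : a ∉ Z := fun h => lt_irrefl _ (hmax a h)
    have ih := ih (fun z hz => hZ z (by simp [hz]))
    rw [Finset.card_insert_of_notMem haZ]
    rcases Z.eq_empty_or_nonempty with rfl | hne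
    · simp
    · have hm := Z.max'_mem hne
      obtain ⟨r, hr, hr0⟩ := exists_hasDerivAt_eq_zero (hmax _ hm)
        (fun x _ => (hG x).continuousAt.continuousWithinAt)
        ((hZ _ (by simp [hm])).trans (hZ a (by simp)).symm) (fun x _ => hG x)
      have hnot : r ∉ R.filter (fun r => ∃ z ∈ Z, r < z) := by
        simp only [Finset.mem_filter, not_and, not_exists]
        intro _ z hz hlt
        exact absurd (Z.le_max' z hz) (not_le.2 (hr.1.trans hlt))
      have hsub : insert r (R.filter (fun r => ∃ z ∈ Z, r < z)) ⊆
          R.filter (fun r => ∃ z ∈ insert a Z, r < z) := by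
        intro t ht
        rcases Finset.mem_insert.1 ht with rfl | ht
        · exact Finset.mem_filter.2 ⟨hR _ hr0, a, by simp, hr.2⟩
        · obtain ⟨h1, z, hz, hlt⟩ := Finset.mem_filter.1 ht
          exact Finset.mem_filter.2 ⟨h1, z, by simp [hz], hlt⟩
      have := Finset.card_le_card hsub
      rw [Finset.card_insert_of_notMem hnot] at this
      omega

/-- Rolle at infinity. -/
lemma rolle_infty (G G' : ℝ → ℝ) (hG : ∀ x, HasDerivAt G (G' x) x) (hc : Continuous G') (a : ℝ)
    (ha : G a = 0) (hlim : Tendsto G atTop (𝓝 0)) : ∃ r, a < r ∧ G' r = 0 := by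
  by_contra! hcon
  wlog hpos : 0 < G' (a + 1) generalizing G G'
  · refine this (fun x => - G x) (fun x => - G' x) (fun x => (hG x).neg) hc.neg (by simp [ha])
      (by simpa using hlim.neg) (fun r hr => neg_ne_zero.2 (hcon r hr)) ?_
    have := hcon (a + 1) (by linarith)
    have := lt_of_le_of_ne (not_lt.1 hpos) this
    linarith
  have hp : ∀ r, a < r → 0 < G' r := by
    intro r hr
    by_contra hneg
    have : (0:ℝ) ∈ G' '' Set.uIcc r (a+1) := by
      apply intermediate_value_uIcc hc.continuousOn
      rw [Set.mem_uIcc]; left; exact ⟨not_lt.1 hneg, hpos.le⟩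
    obtain ⟨t, ht, ht0⟩ := this
    refine hcon t ?_ ht0
    rcases Set.mem_uIcc.1 ht with h | h <;> linarith [h.1]
  have hmono : StrictMonoOn G (Set.Ici a) := by
    apply strictMonoOn_of_deriv_pos (convex_Ici a)
    · exact fun x _ => (hG x).continuousAt.continuousWithinAt
    · intro x hx
      rw [interior_Ici] at hx
      rw [(hG x).deriv]; exact hp x hx
  have h1 : 0 < G (a+1) := by
    rw [← ha]; exact hmono (by simp) (by simp) (by linarith)
  have h2 : G (a+1) ≤ 0 := by
    apply ge_of_tendsto hlim
    filter_upwards [eventually_ge_atTop (a+1)] with x hx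
    exact hmono.monotoneOn (by simp) (by simp; linarith) hx
  linarith

lemma integral_sign (w : ℝ → ℝ) (hw : Integrable w) (y : ℝ) :
    ∫ x, w x * Real.sign (x - y) = (∫ x, w x) - 2 * ∫ x in Set.Iic y, w x := by
  rw [← integral_indicator measurableSet_Iic, ← integral_const_mul,
    ← integral_sub hw ((hw.indicator measurableSet_Iic).const_mul 2)]
  apply integral_congr_ae
  have : ∀ᵐ x : ℝ, x ≠ y := by simp [ae_iff]
  filter_upwards [this] with x hx
  rcases lt_or_gt_of_ne hx with h | h
  · rw [Real.sign_of_neg (by linarith), Set.indicator_of_mem (by exact h.le)]; ring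
  · rw [Real.sign_of_pos (by linarith), Set.indicator_of_notMem (by simpa using h)]; ring

lemma hasDeriv (w : ℝ → ℝ) (hw : Integrable w) (hc : Continuous w) (y : ℝ) :
    HasDerivAt (fun y => (∫ x, w x) - 2 * ∫ x in Set.Iic y, w x) (-2 * w y) y := by
  have h : (fun y => (∫ x, w x) - 2 * ∫ x in Set.Iic y, w x) =
      fun y => (∫ x, w x) - 2 * ((∫ x in Set.Iic 0, w x) + ∫ x in (0:ℝ)..y, w x) := by
    ext y
    rw [← intervalIntegral.integral_Iic_sub_Iic hw.integrableOn hw.integrableOn]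
    ring
  rw [h]
  have h1 := intervalIntegral.integral_hasDerivAt_right (hc.intervalIntegrable 0 y)
    (hc.stronglyMeasurableAtFilter _ _) hc.continuousAt
  have h2 := ((h1.const_add (∫ x in Set.Iic 0, w x)).const_mul 2).const_sub (∫ x, w x)
  rw [neg_mul]
  exact h2

lemma lim_top (w : ℝ → ℝ) (hw : Integrable w) :
    Tendsto (fun y => (∫ x, w x) - 2 * ∫ x in Set.Iic y, w x) atTop (𝓝 (-∫ x, w x)) := by
  have h : Tendsto (fun y => ∫ x in Set.Iic y, w x) atTop (𝓝 (∫ x, w x)) :=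
    (aecover_Iic tendsto_id).integral_tendsto_of_countably_generated hw
  have := (h.const_mul 2).const_sub (∫ x, w x)
  convert this using 2
  ring

lemma lim_bot (w : ℝ → ℝ) (hw : Integrable w) :
    Tendsto (fun y => (∫ x, w x) - 2 * ∫ x in Set.Iic y, w x) atBot (𝓝 (∫ x, w x)) := by
  have h : Tendsto (fun y => ∫ x in Set.Ioi y, w x) atBot (𝓝 (∫ x, w x)) :=
    (aecover_Ioi tendsto_id).integral_tendsto_of_countably_generated hw
  have := (h.const_mul 2).sub_const (∫ x, w x)
  convert this using 2 with y
  · have := intervalIntegral.integral_Iic_add_Ioi (f := w) (b := y) (μ := volume) hw.integrableOn hw.integrableOn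
    linarith
  · ring

lemma skew_add_left (V f f' g : Polynomial ℝ) (hEven : Even V.natDegree) (hdeg : 2 ≤ V.natDegree)
    (hlc : 0 < V.leadingCoeff) : skewInner V (f + f') g = skewInner V f g + skewInner V f' g := by
  unfold skewInner
  rw [← integral_add (integrable_prod V f g hEven hdeg hlc) (integrable_prod V f' g hEven hdeg hlc)]
  congr 1; ext p; simp only [eval_add]; ring

lemma skew_smul_left (V f g : Polynomial ℝ) (c : ℝ) :
    skewInner V (c • f) g = c * skewInner V f g := by
  unfold skewInner
  rw [← integral_const_mul]
  congr 1; ext p; simp only [eval_smul, smul_eq_mul]; ring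

lemma skew_sum_right (V f g : Polynomial ℝ) (hEven : Even V.natDegree) (hdeg : 2 ≤ V.natDegree)
    (hlc : 0 < V.leadingCoeff) (n : ℕ) (hn : g.natDegree < n) :
    skewInner V f g = ∑ j ∈ Finset.range n, g.coeff j * skewInner V f (X ^ j) := by
  unfold skewInner
  simp_rw [← integral_const_mul]
  rw [← integral_finsetSum _ (fun j _ => (integrable_prod V f (X^j) hEven hdeg hlc).const_mul _)]
  congr 1; ext p
  rw [eval_eq_sum_range' hn, Finset.mul_sum, Finset.sum_mul, Finset.sum_mul]
  apply Finset.sum_congr rfl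
  intro j _
  simp only [eval_pow, eval_X]; ring

lemma skew_fubini (V f g : Polynomial ℝ) (hEven : Even V.natDegree) (hdeg : 2 ≤ V.natDegree)
    (hlc : 0 < V.leadingCoeff) (G : ℝ → ℝ)
    (hG : ∀ y, G y = (∫ x, f.eval x * Real.exp (-V.eval x)) -
      2 * ∫ x in Set.Iic y, f.eval x * Real.exp (-V.eval x)) :
    Integrable (fun y => G y * g.eval y * Real.exp (-V.eval y)) ∧
    skewInner V f g = ∫ y, G y * g.eval y * Real.exp (-V.eval y) := by
  have hi := integrable_prod V f g hEven hdeg hlc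
  have e : ∀ y, ∫ x, f.eval x * g.eval y * Real.sign (x - y) *
      Real.exp (-V.eval x - V.eval y) = G y * g.eval y * Real.exp (-V.eval y) := by
    intro y
    rw [hG, ← integral_sign _ (integrable_w V f hEven hdeg hlc), mul_assoc, ← integral_mul_const]
    congr 1; ext x
    rw [sub_eq_add_neg (-V.eval x), Real.exp_add]; ring
  constructor
  · refine (Integrable.integral_prod_right hi).congr (Eventually.of_forall e)
  · unfold skewInner
    rw [Measure.volume_eq_prod, integral_prod_symm _ hi]
    exact integral_congr_ae (Eventually.of_forall e)

lemma nondeg (V : Polynomial ℝ) (hEven : Even V.natDegree) (hdeg : 2 ≤ V.natDegree)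
    (hlc : 0 < V.leadingCoeff) (k : ℕ) (q : Polynomial ℝ) (hq : q.degree < (2 * k : ℕ))
    (h : ∀ j < 2 * k, skewInner V q (X ^ j) = 0) : q = 0 := by
  by_contra hq0
  have hqn : q.natDegree < 2 * k := (natDegree_lt_iff_degree_lt hq0).2 hq
  set w : ℝ → ℝ := fun x => q.eval x * Real.exp (-V.eval x) with hw
  have hwi : Integrable w := integrable_w V q hEven hdeg hlc
  have hwc : Continuous w := by rw [hw]; fun_prop
  set G : ℝ → ℝ := fun y => (∫ x, w x) - 2 * ∫ x in Set.Iic y, w x with hGdef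
  have hGd : ∀ y, HasDerivAt G (-2 * w y) y := hasDeriv w hwi hwc
  have hGc : Continuous G := continuous_iff_continuousAt.2 fun x => (hGd x).continuousAt
  have horth : ∀ g : ℝ[X], g.natDegree < 2 * k →
      ∫ y, G y * g.eval y * Real.exp (-V.eval y) = 0 := by
    intro g hg
    rw [← (skew_fubini V q g hEven hdeg hlc G (fun y => rfl)).2,
      skew_sum_right V q g hEven hdeg hlc _ hg]
    exact Finset.sum_eq_zero fun j hj => by rw [h j (Finset.mem_range.1 hj), mul_zero]
  set R := q.roots.toFinset with hRdef
  have hR : ∀ x, -2 * w x = 0 → x ∈ R := by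
    intro x hx
    have : q.eval x = 0 := by
      simpa [hw, Real.exp_ne_zero] using hx
    simp [hRdef, hq0, this]
  have hRc : R.card ≤ 2 * k - 1 := by
    have h1 := Multiset.toFinset_card_le q.roots
    have h2 := q.card_roots'
    rw [← hRdef] at h1
    omega
  have hfin : {x | G x = 0}.Finite := by
    by_contra hinf
    obtain ⟨T, hT, hTc⟩ := Set.Infinite.exists_subset_card_eq hinf (R.card + 2)
    have h1 := rolle_count G _ hGd R hR T (fun z hz => hT hz)
    have h2 := Finset.card_filter_le R (fun r => ∃ z ∈ T, r < z)
    omega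
  set Z := hfin.toFinset with hZdef
  have hZm : ∀ x, x ∈ Z ↔ G x = 0 := by intro x; simp [hZdef]
  obtain ⟨S, hSZ, hS⟩ := sc (↑Z) Z G (fun x hx => by simpa [hZm] using hx) subset_rfl (by
    intro x y hxy hx hy hz
    have hx : G x ≠ 0 := by simpa [hZm] using hx
    have hy : G y ≠ 0 := by simpa [hZm] using hy
    by_contra hneg
    have hneg : G x * G y < 0 := lt_of_le_of_ne (not_lt.1 hneg) (mul_ne_zero hx hy)
    have : (0:ℝ) ∈ G '' Set.uIcc x y := by
      apply intermediate_value_uIcc hGc.continuousOn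
      rw [Set.mem_uIcc]
      rcases mul_neg_iff.1 hneg with h | h
      · right; exact ⟨h.2.le, h.1.le⟩
      · left; exact ⟨h.1.le, h.2.le⟩
    obtain ⟨t, ht, ht0⟩ := this
    rw [Set.uIcc_of_le hxy.le] at ht
    refine hz t ((hZm t).2 ht0) ⟨lt_of_le_of_ne ht.1 ?_, lt_of_le_of_ne ht.2 ?_⟩
    · rintro rfl; exact hx ht0
    · rintro rfl; exact hy ht0)
  have hScard : 2 * k ≤ S.card := by
    by_contra! hlt
    set P : ℝ[X] := ∏ z ∈ S, (X - C z) with hP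
    have hPdeg : P.natDegree = S.card := by
      rw [hP, natDegree_prod_of_monic _ _ (fun z _ => monic_X_sub_C z)]; simp
    have hPe : ∀ x, P.eval x = ∏ z ∈ S, (x - z) := by
      intro x; rw [hP, eval_prod]; simp
    obtain ⟨x0, hx0⟩ := Infinite.exists_notMem_finset Z
    have hpos : ∀ y ∉ Z, 0 < (G x0 * P.eval x0) * (G y * P.eval y) := by
      intro y hy
      simp only [hPe]
      rcases lt_trichotomy x0 y with hh | hh | hh
      · exact hS x0 y hh (by simpa using hx0) (by simpa using hy)
      · subst hh
        apply mul_self_pos.2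
        obtain ⟨y1, hy1⟩ := Set.Infinite.nonempty
          ((Set.Ioi_infinite x0).sdiff Z.finite_toSet)
        exact left_ne_zero_of_mul (hS x0 y1 hy1.1 (by simpa using hx0) hy1.2).ne'
      · rw [mul_comm]; exact hS y x0 hh (by simpa using hy) (by simpa using hx0)
    have hint := (skew_fubini V q P hEven hdeg hlc G (fun y => rfl)).1.const_mul (G x0 * P.eval x0)
    have h0 := horth P (by omega)
    have hae : ∀ᵐ y : ℝ, y ∉ Z := by
      rw [ae_iff]; simp only [not_not]; exact Z.finite_toSet.measure_zero _
    have hnn : 0 ≤ᵐ[volume] fun y => (G x0 * P.eval x0) * (G y * P.eval y * Real.exp (-V.eval y)) := by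
      filter_upwards [hae] with y hy
      have := mul_pos (hpos y hy) (Real.exp_pos (-V.eval y))
      simp only [Pi.zero_apply]
      nlinarith [this]
    have hz := (integral_eq_zero_iff_of_nonneg_ae hnn hint).1 (by
      rw [integral_const_mul, h0, mul_zero])
    have : ∀ᵐ y : ℝ, False := by
      filter_upwards [hz, hae] with y hy hyz
      have := mul_pos (hpos y hyz) (Real.exp_pos (-V.eval y))
      simp only [Pi.zero_apply] at hy
      nlinarith [this]
    exact this.exists.elim fun _ h => h
  have hSZc := Finset.card_le_card hSZ
  have hcount := rolle_count G _ hGd R hR Z (fun z hz => (hZm z).1 hz)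
  have hZne : Z.Nonempty := Finset.card_pos.1 (by omega)
  by_cases hc : ∫ x, w x = 0
  · obtain ⟨r, hr, hr0⟩ := rolle_infty G _ hGd (by fun_prop) (Z.max' hZne)
      ((hZm _).1 (Z.max'_mem hZne)) (by have := lim_top w hwi; rwa [show -∫ x, w x = 0 by rw [hc, neg_zero]] at this)
    have hnot : r ∉ R.filter (fun r => ∃ z ∈ Z, r < z) := by
      simp only [Finset.mem_filter, not_and, not_exists]
      intro _ z hz hlt
      exact absurd (Z.le_max' z hz) (not_le.2 (hr.trans hlt))
    have hsub : insert r (R.filter (fun r => ∃ z ∈ Z, r < z)) ⊆ R :=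
      Finset.insert_subset (hR r hr0) (Finset.filter_subset _ _)
    have := Finset.card_le_card hsub
    rw [Finset.card_insert_of_notMem hnot] at this
    omega
  · have hfl := Finset.card_filter_le R (fun r => ∃ z ∈ Z, r < z)
    have hSe : S.card = 2 * k := by omega
    have hZf : ∀ᶠ x in atBot, ∀ z ∈ Z, x < z :=
      (Finset.eventually_all Z).2 fun z _ => eventually_lt_atBot z
    have hZt : ∀ᶠ x in atTop, ∀ z ∈ Z, z < x :=
      (Finset.eventually_all Z).2 fun z _ => eventually_gt_atTop z
    have hb : ∀ᶠ x in atBot, 0 < (∫ x, w x) * G x :=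
      ((lim_bot w hwi).const_mul (∫ x, w x)).eventually_const_lt (mul_self_pos.2 hc)
    have ht : ∀ᶠ x in atTop, (∫ x, w x) * G x < 0 :=
      ((lim_top w hwi).const_mul (∫ x, w x)).eventually_lt_const (by
        have := mul_self_pos.2 hc; linarith)
    obtain ⟨x, hx1, hx2⟩ := (hZf.and hb).exists
    obtain ⟨y, hy1, hy2⟩ := (hZt.and ht).exists
    obtain ⟨z0, hz0⟩ := hZne
    have hxy : x < y := (hx1 z0 hz0).trans (hy1 z0 hz0)
    have key := hS x y hxy (fun hh => lt_irrefl _ (hx1 x hh)) (fun hh => lt_irrefl _ (hy1 y hh))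
    have p1 : 0 < ∏ z ∈ S, (x - z) := by
      have : ∏ z ∈ S, (x - z) = ∏ z ∈ S, (z - x) := by
        have : ∏ z ∈ S, (x - z) = ∏ z ∈ S, ((-1) * (z - x)) := by
          apply Finset.prod_congr rfl; intros; ring
        rw [this, Finset.prod_mul_distrib, Finset.prod_const, hSe,
          (even_two_mul k).neg_one_pow, one_mul]
      rw [this]
      exact Finset.prod_pos fun z hz => sub_pos.2 (hx1 z (hSZ hz))
    have p2 : 0 < ∏ z ∈ S, (y - z) := Finset.prod_pos fun z hz => sub_pos.2 (hy1 z (hSZ hz))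
    have k1 : 0 < G x * G y := by
      have : 0 < (G x * G y) * ((∏ z ∈ S, (x - z)) * ∏ z ∈ S, (y - z)) := by linarith [key]
      exact pos_of_mul_pos_left this (mul_pos p1 p2).le
    have k2 := mul_neg_of_pos_of_neg hx2 hy2
    have k3 := mul_pos (mul_self_pos.2 hc) k1
    linarith

end SkewAux

open SkewAux in
/-- For every `k ≥ 0` there is a unique monic polynomial `p_{2k+1}` of degree `2k+1`,
with vanishing coefficient of `x^{2k}`, such that `⟨p_{2k+1}, y^j⟩₁ = 0` for all
`0 ≤ j ≤ 2k − 1`. -/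
theorem skew_orthogonal_odd_exists_unique
    (V : Polynomial ℝ) (hEven : Even V.natDegree) (hdeg : 2 ≤ V.natDegree)
    (hlc : 0 < V.leadingCoeff) (k : ℕ) :
    ∃! p : Polynomial ℝ, p.Monic ∧ p.natDegree = 2 * k + 1 ∧ p.coeff (2 * k) = 0 ∧
      ∀ j < 2 * k, skewInner V p (X ^ j) = 0 := by
  let L : degreeLT ℝ (2 * k) →ₗ[ℝ] (Fin (2 * k) → ℝ) :=
    { toFun := fun q j => skewInner V q.1 (X ^ (j : ℕ))
      map_add' := fun q q' => by
        ext j; exact skew_add_left V q.1 q'.1 _ hEven hdeg hlc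
      map_smul' := fun c q => by
        ext j; exact skew_smul_left V q.1 _ c }
  have hinj : Function.Injective L := by
    rw [← LinearMap.ker_eq_bot, LinearMap.ker_eq_bot']
    intro q hq
    apply Subtype.ext
    exact nondeg V hEven hdeg hlc k q.1 (mem_degreeLT.1 q.2)
      (fun j hj => congrFun hq ⟨j, hj⟩)
  have hsurj : Function.Surjective L := by
    have e := degreeLTEquiv ℝ (2 * k)
    have : FiniteDimensional ℝ (degreeLT ℝ (2 * k)) := Module.Finite.equiv e.symm
    exact (LinearMap.injective_iff_surjective_of_finrank_eq_finrank e.finrank_eq).1 hinj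
  obtain ⟨q, hq⟩ := hsurj (fun j => - skewInner V (X ^ (2 * k + 1)) (X ^ (j : ℕ)))
  have hqd := mem_degreeLT.1 q.2
  have hqd' : q.1.degree < ((2 * k + 1 : ℕ) : WithBot ℕ) :=
    hqd.trans (by exact_mod_cast Nat.lt_succ_self _)
  refine ⟨X ^ (2 * k + 1) + q.1, ⟨monic_X_pow_add hqd', ?_, ?_, ?_⟩, ?_⟩
  · exact natDegree_eq_of_degree_eq_some (by
      rw [degree_add_eq_left_of_degree_lt (by rwa [degree_X_pow]), degree_X_pow])
  · rw [coeff_add, coeff_X_pow, coeff_eq_zero_of_degree_lt hqd]; simp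
  · intro j hj
    rw [skew_add_left V _ _ _ hEven hdeg hlc]
    have : skewInner V q.1 (X ^ j) = _ := congrFun hq ⟨j, hj⟩
    rw [this]; simp
  · rintro p ⟨hm, hd, hc, hp⟩
    have hr : p - X ^ (2 * k + 1) ∈ degreeLT ℝ (2 * k) := by
      rw [mem_degreeLT, degree_lt_iff_coeff_zero]
      intro m hmk
      rw [coeff_sub, coeff_X_pow]
      rcases Nat.lt_or_ge (2 * k + 1) m with h1 | h1
      · rw [coeff_eq_zero_of_natDegree_lt (by omega), if_neg (by omega), sub_zero]
      · rcases (show m = 2 * k ∨ m = 2 * k + 1 by omega) with rfl | rfl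
        · rw [hc]; simp
        · have := hm.coeff_natDegree
          rw [hd] at this
          rw [this]; simp
    have heq : (⟨_, hr⟩ : degreeLT ℝ (2 * k)) = q := by
      apply hinj
      rw [hq]
      ext j
      have h1 := hp j j.2
      have h2 := skew_add_left V (X ^ (2 * k + 1)) (p - X ^ (2 * k + 1)) (X ^ (j : ℕ)) hEven hdeg hlc
      rw [add_sub_cancel, h1] at h2
      change skewInner V (p - X ^ (2 * k + 1)) (X ^ (j : ℕ)) = _
      linarith
    rw [← heq]; simp
end

section
/- Let k satisfy 2k ≥ d and let 0 ≤ m ≤ d−2. If q is a nonzero polynomial of degree at most 2k−1 such that ⟨q, x^j⟩₂ = 0 for all 0 ≤ j ≤ 2k−d and ⟨q, y^n⟩₁ = 0 for all 0 ≤ n ≤ d−2 with n ≠ m, then ⟨q, y^m⟩₁ ≠ 0. -/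
open MeasureTheory Polynomial

/-- The inner product `⟨f,g⟩₂ = ∫ f(x) g(x) e^{−2V(x)} dx`. -/
noncomputable def innerTwo (V f g : Polynomial ℝ) : ℝ :=
  ∫ x : ℝ, f.eval x * g.eval x * Real.exp (-2 * V.eval x)

section Aux
open Filter Topology Set

/-- Exponential decay towards `+∞`. -/
lemma aux_isBigO (V f : Polynomial ℝ) (hdeg : 2 ≤ V.natDegree) (hlc : 0 < V.leadingCoeff) :
    (fun x : ℝ => f.eval x * Real.exp (-V.eval x)) =O[atTop] fun x => Real.exp (-1 * x) := by
  have hX : ((C 2 * X : Polynomial ℝ)).degree < V.degree := by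
    rw [degree_eq_natDegree (p := V) (by rintro rfl; simp at hlc)]
    refine (degree_C_mul_X_le 2).trans_lt ?_
    exact_mod_cast (by omega : 1 < V.natDegree)
  have hlc' : (V - C 2 * X).leadingCoeff = V.leadingCoeff := leadingCoeff_sub_of_degree_lt hX
  have hdeg' : (V - C 2 * X).degree = V.degree := degree_sub_eq_left_of_degree_lt hX
  have ht : Tendsto (fun x => (V - C 2 * X).eval x) atTop atTop := by
    apply tendsto_atTop_of_leadingCoeff_nonneg
    · rw [hdeg', ← natDegree_pos_iff_degree_pos]; omega
    · rw [hlc']; exact hlc.le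
  have h1 := f.tendsto_div_exp_atTop
  have h1' := h1.isBigO_one ℝ
  have h2 : (fun x : ℝ => Real.exp (x - V.eval x)) =O[atTop] fun x => Real.exp (-1 * x) := by
    apply Asymptotics.IsBigO.of_bound 1
    filter_upwards [ht.eventually_ge_atTop 0] with x hx
    simp at hx
    rw [Real.norm_of_nonneg (Real.exp_pos _).le, Real.norm_of_nonneg (Real.exp_pos _).le, one_mul]
    apply Real.exp_le_exp.2
    linarith
  have h3 := h1'.mul h2
  simp only [one_mul] at h3
  refine h3.congr_left ?_
  intro x
  rw [Real.exp_sub, Real.exp_neg]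
  field_simp

lemma aux_integrable (V f : Polynomial ℝ) (hEven : Even V.natDegree) (hdeg : 2 ≤ V.natDegree)
    (hlc : 0 < V.leadingCoeff) :
    Integrable (fun x : ℝ => f.eval x * Real.exp (-V.eval x)) := by
  have key : ∀ W g : Polynomial ℝ, 2 ≤ W.natDegree → 0 < W.leadingCoeff →
      IntegrableOn (fun x : ℝ => g.eval x * Real.exp (-W.eval x)) (Ioi 0) := by
    intro W g h1 h2
    exact integrable_of_isBigO_exp_neg one_pos (by fun_prop) (aux_isBigO W g h1 h2)
  rw [← integrableOn_univ, ← Iic_union_Ioi (a := (0:ℝ))]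
  refine IntegrableOn.union ?_ (key V f hdeg hlc)
  have := key (V.comp (-X)) (f.comp (-X)) (by simpa [natDegree_comp] using hdeg)
    (by rw [comp_neg_X_leadingCoeff_eq, hEven.neg_one_pow]; simpa using hlc)
  have h4 : Integrable ((Ioi (0:ℝ)).indicator
      (fun x : ℝ => (f.comp (-X)).eval x * Real.exp (-(V.comp (-X)).eval x))) :=
    this.integrable_indicator measurableSet_Ioi
  have h5 := h4.comp_neg
  rw [integrableOn_Iic_iff_integrableOn_Iio, ← integrable_indicator_iff measurableSet_Iio]
  refine h5.congr (ae_of_all _ fun x => ?_)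
  simp [indicator]

/-- The primitive `Φ(y) = ∫ q(x) ε(x-y) e^{-V(x)} dx`. -/
noncomputable def auxPhi (V q : Polynomial ℝ) (y : ℝ) : ℝ :=
  (∫ x : ℝ, q.eval x * Real.exp (-V.eval x)) -
    2 * ∫ x in Iic y, q.eval x * Real.exp (-V.eval x)

lemma auxPhi_hasDerivAt (V q : Polynomial ℝ)
    (hi : Integrable (fun x : ℝ => q.eval x * Real.exp (-V.eval x))) (y : ℝ) :
    HasDerivAt (auxPhi V q) (-2 * (q.eval y * Real.exp (-V.eval y))) y := by
  have hc : Continuous (fun x : ℝ => q.eval x * Real.exp (-V.eval x)) := by fun_prop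
  have h1 : auxPhi V q = fun y => ((∫ x : ℝ, q.eval x * Real.exp (-V.eval x)) -
      2 * ((∫ x in Iic 0, q.eval x * Real.exp (-V.eval x)) +
      ∫ x in (0:ℝ)..y, q.eval x * Real.exp (-V.eval x))) := by
    funext y
    rw [auxPhi, ← intervalIntegral.integral_Iic_sub_Iic hi.integrableOn hi.integrableOn]
    ring
  rw [h1]
  have h2 := hc.integral_hasStrictDerivAt 0 y
  have := ((h2.hasDerivAt.const_add
    (∫ x in Iic 0, q.eval x * Real.exp (-V.eval x))).const_mul 2).const_sub
    (∫ x : ℝ, q.eval x * Real.exp (-V.eval x))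
  exact this.congr_deriv (by ring)

lemma auxPhi_atTop (V q : Polynomial ℝ)
    (hi : Integrable (fun x : ℝ => q.eval x * Real.exp (-V.eval x))) :
    Tendsto (auxPhi V q) atTop (𝓝 (-∫ x : ℝ, q.eval x * Real.exp (-V.eval x))) := by
  have h := (aecover_Iic (μ := volume) (l := atTop)
    (tendsto_id (α := ℝ))).integral_tendsto_of_countably_generated hi
  have := (h.const_mul 2).const_sub (∫ x : ℝ, q.eval x * Real.exp (-V.eval x))
  refine this.trans (le_of_eq ?_)
  congr 1
  ring

lemma auxPhi_atBot (V q : Polynomial ℝ)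
    (hi : Integrable (fun x : ℝ => q.eval x * Real.exp (-V.eval x))) :
    Tendsto (auxPhi V q) atBot (𝓝 (∫ x : ℝ, q.eval x * Real.exp (-V.eval x))) := by
  have h := (aecover_Ioi (μ := volume) (l := atBot)
    (tendsto_id (α := ℝ))).integral_tendsto_of_countably_generated hi
  have := (h.const_mul 2).sub_const (∫ x : ℝ, q.eval x * Real.exp (-V.eval x))
  have h2 : auxPhi V q = fun y => 2 * (∫ x in Ioi y, q.eval x * Real.exp (-V.eval x)) -
      (∫ x : ℝ, q.eval x * Real.exp (-V.eval x)) := by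
    funext y
    rw [auxPhi, ← intervalIntegral.integral_Iic_add_Ioi (b := y) hi.integrableOn hi.integrableOn]
    ring
  rw [h2]
  refine this.trans (le_of_eq ?_)
  congr 1
  ring

lemma auxPhi_bdd (V q : Polynomial ℝ)
    (hi : Integrable (fun x : ℝ => q.eval x * Real.exp (-V.eval x))) :
    ∃ B : ℝ, ∀ y, ‖auxPhi V q y‖ ≤ B := by
  refine ⟨‖∫ x : ℝ, q.eval x * Real.exp (-V.eval x)‖ +
    2 * ∫ x : ℝ, ‖q.eval x * Real.exp (-V.eval x)‖, fun y => ?_⟩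
  refine (norm_sub_le _ _).trans ?_
  gcongr
  rw [norm_mul, Real.norm_ofNat]
  gcongr
  refine (norm_integral_le_integral_norm _).trans ?_
  exact setIntegral_le_integral hi.norm (ae_of_all _ fun x => norm_nonneg _)

lemma auxPhi_mul_integrable (V q g : Polynomial ℝ)
    (hq : Integrable (fun x : ℝ => q.eval x * Real.exp (-V.eval x)))
    (hg : Integrable (fun x : ℝ => g.eval x * Real.exp (-V.eval x))) :
    Integrable (fun y : ℝ => auxPhi V q y * (g.eval y * Real.exp (-V.eval y))) := by
  obtain ⟨B, hB⟩ := auxPhi_bdd V q hq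
  have hc : Continuous (auxPhi V q) :=
    continuous_iff_continuousAt.2 fun y => (auxPhi_hasDerivAt V q hq y).continuousAt
  exact hg.bdd_mul hc.aestronglyMeasurable (ae_of_all _ hB)

lemma aux_sign (V q : Polynomial ℝ)
    (hi : Integrable (fun x : ℝ => q.eval x * Real.exp (-V.eval x))) (y : ℝ) :
    ∫ x : ℝ, q.eval x * Real.exp (-V.eval x) * Real.sign (x - y) = auxPhi V q y := by
  have h1 : auxPhi V q y = ∫ x : ℝ, (q.eval x * Real.exp (-V.eval x) -
      2 * (Iic y).indicator (fun x => q.eval x * Real.exp (-V.eval x)) x) := by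
    rw [integral_sub hi ((hi.indicator measurableSet_Iic).const_mul 2), integral_const_mul,
      integral_indicator measurableSet_Iic, auxPhi]
  rw [h1]
  apply integral_congr_ae
  have : ∀ᵐ x : ℝ, x ≠ y := by
    simp [ae_iff]
  filter_upwards [this] with x hx
  rcases lt_or_gt_of_ne hx with h | h
  · rw [Real.sign_of_neg (by linarith), indicator_of_mem (show x ∈ Iic y from h.le)]
    ring
  · rw [Real.sign_of_pos (by linarith), indicator_of_notMem (by simpa using h)]
    ring

lemma aux_skew (V q g : Polynomial ℝ)
    (hq : Integrable (fun x : ℝ => q.eval x * Real.exp (-V.eval x)))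
    (hg : Integrable (fun x : ℝ => g.eval x * Real.exp (-V.eval x))) :
    skewInner V q g = ∫ y : ℝ, auxPhi V q y * (g.eval y * Real.exp (-V.eval y)) := by
  have hsm : Measurable Real.sign := by
    unfold Real.sign
    exact Measurable.ite (measurableSet_lt measurable_id measurable_const) measurable_const
      (Measurable.ite (measurableSet_lt measurable_const measurable_id) measurable_const
        measurable_const)
  have hint : Integrable (fun p : ℝ × ℝ => q.eval p.1 * g.eval p.2 * Real.sign (p.1 - p.2) *
    Real.exp (-V.eval p.1 - V.eval p.2)) (volume.prod volume) := by
    have h1 := hq.mul_prod hg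
    have h2 : Measurable (fun p : ℝ × ℝ => Real.sign (p.1 - p.2)) :=
      hsm.comp (measurable_fst.sub measurable_snd)
    have h3 : ∀ p : ℝ × ℝ, ‖Real.sign (p.1 - p.2)‖ ≤ 1 := by
      intro p
      rcases Real.sign_apply_eq (p.1 - p.2) with h | h | h <;> rw [h] <;> simp
    refine (h1.bdd_mul h2.aestronglyMeasurable (ae_of_all _ h3)).congr (ae_of_all _ fun p => ?_)
    simp only [sub_eq_add_neg, Real.exp_add]
    ring
  rw [skewInner, Measure.volume_eq_prod, integral_prod_symm _ hint]
  apply integral_congr_ae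
  refine ae_of_all _ fun y => ?_
  simp only
  rw [← aux_sign V q hq, ← integral_mul_const]
  apply integral_congr_ae
  refine ae_of_all _ fun x => ?_
  simp only [sub_eq_add_neg, Real.exp_add]
  ring

lemma aux_parts (V q p : Polynomial ℝ) (hEven : Even V.natDegree) (hdeg : 2 ≤ V.natDegree)
    (hlc : 0 < V.leadingCoeff) :
    ∫ y : ℝ, auxPhi V q y * ((derivative p - p * derivative V).eval y * Real.exp (-V.eval y)) =
      2 * innerTwo V q p := by
  have hI := fun f => aux_integrable V f hEven hdeg hlc
  have h2V : (C 2 * V).natDegree = V.natDegree := natDegree_C_mul (by norm_num)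
  have hI2 := aux_integrable (C 2 * V) (q * p) (by rwa [h2V]) (by rwa [h2V])
    (by rw [leadingCoeff_mul, leadingCoeff_C]; positivity)
  have hd : ∀ y : ℝ, HasDerivAt (fun y => p.eval y * Real.exp (-V.eval y))
      ((derivative p - p * derivative V).eval y * Real.exp (-V.eval y)) y := by
    intro y
    have := (p.hasDerivAt y).mul (V.hasDerivAt y).neg.exp
    refine this.congr_deriv ?_
    simp
    ring
  have he : ∀ y : ℝ, -2 * (q.eval y * Real.exp (-V.eval y)) * (p.eval y * Real.exp (-V.eval y)) =
      -2 * ((q * p).eval y * Real.exp (-(C 2 * V).eval y)) := by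
    intro y
    have : Real.exp (-(C 2 * V).eval y) = Real.exp (-V.eval y) * Real.exp (-V.eval y) := by
      rw [← Real.exp_add]; simp; ring
    rw [this, eval_mul]
    ring
  rw [integral_mul_deriv_eq_deriv_mul_of_integrable (u := auxPhi V q)
    (u' := fun y => -2 * (q.eval y * Real.exp (-V.eval y)))
    (v := fun y => p.eval y * Real.exp (-V.eval y))
    (fun x _ => auxPhi_hasDerivAt V q (hI q) x) (fun x _ => hd x)
    (auxPhi_mul_integrable V q _ (hI q) (hI _))
    ((hI2.const_mul (-2)).congr (ae_of_all _ fun y => (he y).symm))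
    (auxPhi_mul_integrable V q _ (hI q) (hI _))]
  simp only [he]
  rw [integral_const_mul, innerTwo]
  simp

/-- All moments vanish. -/
lemma aux_moments (V : Polynomial ℝ) (hEven : Even V.natDegree) (hdeg : 2 ≤ V.natDegree)
    (hlc : 0 < V.leadingCoeff) (k : ℕ) (q : Polynomial ℝ)
    (h2 : ∀ j : ℕ, j + V.natDegree ≤ 2 * k → innerTwo V q (X ^ j) = 0)
    (h1 : ∀ n : ℕ, n + 2 ≤ V.natDegree → skewInner V q (X ^ n) = 0) :
    ∀ n : ℕ, n ≤ 2 * k → ∀ g : Polynomial ℝ, g.degree < n →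
      ∫ y : ℝ, auxPhi V q y * (g.eval y * Real.exp (-V.eval y)) = 0 := by
  have hI := fun f => aux_integrable V f hEven hdeg hlc
  have hJ := fun g => auxPhi_mul_integrable V q g (hI q) (hI g)
  intro n
  induction n with
  | zero =>
    intro _ g hg
    have : g = 0 := by simpa using hg
    simp [this]
  | succ n ih =>
    intro hn g hg
    have hR : ∃ R : Polynomial ℝ, R.natDegree ≤ n ∧ R.coeff n ≠ 0 ∧
        ∫ y : ℝ, auxPhi V q y * (R.eval y * Real.exp (-V.eval y)) = 0 := by
      by_cases hc : n + 2 ≤ V.natDegree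
      · refine ⟨X ^ n, by simp, by simp, ?_⟩
        rw [← aux_skew V q _ (hI q) (hI _)]
        exact h1 n hc
      · obtain ⟨j, hj⟩ : ∃ j, n = j + (V.natDegree - 1) := ⟨n - (V.natDegree - 1), by omega⟩
        have hV' : (derivative V).natDegree ≤ V.natDegree - 1 := natDegree_derivative_le V
        refine ⟨derivative (X ^ j) - X ^ j * derivative V, ?_, ?_, ?_⟩
        · refine (natDegree_sub_le _ _).trans (max_le ?_ ?_)
          · refine (natDegree_derivative_le _).trans ?_
            simp; omega
          · refine natDegree_mul_le.trans ?_
            simp; omega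
        · have e1 : (derivative (X ^ j : Polynomial ℝ)).coeff n = 0 := by
            rw [coeff_derivative, coeff_X_pow, if_neg (by omega), zero_mul]
          rw [coeff_sub, e1, hj, add_comm j, coeff_X_pow_mul, coeff_derivative,
            Nat.sub_add_cancel (by omega), zero_sub, neg_ne_zero]
          exact mul_ne_zero hlc.ne' (by positivity)
        · rw [aux_parts V q _ hEven hdeg hlc, h2 j (by omega), mul_zero]
    obtain ⟨R, hR1, hR2, hR3⟩ := hR
    have hg' : g.natDegree ≤ n := by
      rw [natDegree_le_iff_coeff_eq_zero]
      intro N hN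
      exact (degree_lt_iff_coeff_zero g (n + 1)).1 hg N hN
    set c : ℝ := g.coeff n / R.coeff n with hc
    have hlow : (g - C c * R).degree < n := by
      rw [degree_lt_iff_coeff_zero]
      intro m hm
      rcases hm.eq_or_lt with rfl | hm
      · simp [hc, hR2]
      · rw [coeff_sub, coeff_C_mul, coeff_eq_zero_of_natDegree_lt (by omega),
          coeff_eq_zero_of_natDegree_lt (by omega)]
        simp
    have h5 := ih (by omega) _ hlow
    have h6 : ∀ y, auxPhi V q y * (g.eval y * Real.exp (-V.eval y)) =
        auxPhi V q y * ((g - C c * R).eval y * Real.exp (-V.eval y)) +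
        c * (auxPhi V q y * (R.eval y * Real.exp (-V.eval y))) := by
      intro y; simp; ring
    simp only [h6]
    rw [integral_add (hJ _) ((hJ _).const_mul c), integral_const_mul, h5, hR3]
    simp

/-- Sign pattern: multiply by linear factors to obtain constant sign. -/
lemma aux_signs (E : Finset ℝ) (Z : Finset ℝ) : ∀ f : ℝ → ℝ, (∀ x, x ∉ E → f x ≠ 0) →
    Z ⊆ E →
    (∀ x y, x < y → x ∉ E → y ∉ E → (∀ z ∈ Z, z ∉ Icc x y) → 0 < f x * f y) →
    ∃ S : Finset ℝ, S ⊆ Z ∧ ∀ x y, x < y → x ∉ E → y ∉ E →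
      0 < (f x * ∏ s ∈ S, (x - s)) * (f y * ∏ s ∈ S, (y - s)) := by
  induction Z using Finset.induction_on with
  | empty =>
    intro f _ _ h
    exact ⟨∅, by simp, fun x y hxy hx hy => by simpa using h x y hxy hx hy (by simp)⟩
  | insert z Z hz ih =>
    intro f hf hZE h
    have hzE : z ∈ E := hZE (Finset.mem_insert_self _ _)
    have hZE' : Z ⊆ E := fun a ha => hZE (Finset.mem_insert_of_mem ha)
    by_cases hcase : ∀ x y, x < y → x ∉ E → y ∉ E → (∀ w ∈ Z, w ∉ Icc x y) → 0 < f x * f y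
    · obtain ⟨S, hS, hS'⟩ := ih f hf hZE' hcase
      exact ⟨S, hS.trans (Finset.subset_insert _ _), hS'⟩
    · push Not at hcase
      obtain ⟨a, b, hab, ha, hb, hZab, hfab⟩ := hcase
      have hfab' : f a * f b < 0 := lt_of_le_of_ne hfab (mul_ne_zero (hf a ha) (hf b hb))
      have hne : ∀ x, x ∉ E → x ≠ z := fun x hx hxz => hx (hxz ▸ hzE)
      have haz : a < z ∧ z < b := by
        by_contra hcon
        have : 0 < f a * f b := by
          apply h a b hab ha hb
          intro w hw
          rcases Finset.mem_insert.1 hw with rfl | hw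
          · rintro ⟨h1, h2⟩
            exact hcon ⟨lt_of_le_of_ne h1 (hne a ha), lt_of_le_of_ne h2 (hne b hb).symm⟩
          · exact hZab w hw
        linarith
      -- same sign on both sides
      have hsame : ∀ u v, u ∉ E → v ∉ E → (∀ w ∈ insert z Z, w ∉ uIcc u v) → 0 < f u * f v := by
        intro u v hu hv huv
        rcases lt_trichotomy u v with hlt | rfl | hlt
        · exact h u v hlt hu hv (by simpa [uIcc_of_le hlt.le] using huv)
        · exact mul_self_pos.2 (hf u hu)
        · rw [mul_comm]
          exact h v u hlt hv hu (by simpa [uIcc_of_ge hlt.le] using huv)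
      obtain ⟨S, hS, hS'⟩ := ih (fun x => f x * (x - z))
        (fun x hx => mul_ne_zero (hf x hx) (sub_ne_zero.2 (hne x hx))) hZE' (by
          intro x y hxy hx hy hZxy
          by_cases hzxy : x < z ∧ z < y
          · have e1 : 0 < f x * f a := by
              apply hsame x a hx ha
              intro w hw
              rcases Finset.mem_insert.1 hw with rfl | hw
              · intro hmem
                rw [mem_uIcc] at hmem
                rcases hmem with hm | hm <;> linarith [hm.1, hm.2]
              · intro hmem
                rw [mem_uIcc] at hmem
                have q1 := hZxy w hw
                have q2 := hZab w hw
                rw [mem_Icc] at q1 q2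
                rcases hmem with hm | hm
                · exact q1 ⟨hm.1, by linarith [hm.2]⟩
                · exact q2 ⟨hm.1, by linarith [hm.2]⟩
            have e2 : 0 < f y * f b := by
              apply hsame y b hy hb
              intro w hw
              rcases Finset.mem_insert.1 hw with rfl | hw
              · intro hmem
                rw [mem_uIcc] at hmem
                rcases hmem with hm | hm <;> linarith [hm.1, hm.2]
              · intro hmem
                rw [mem_uIcc] at hmem
                have q1 := hZxy w hw
                have q2 := hZab w hw
                rw [mem_Icc] at q1 q2
                rcases hmem with hm | hm
                · exact q2 ⟨by linarith [hm.1], hm.2⟩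
                · exact q1 ⟨by linarith [hm.1], hm.2⟩
            have e3 : f x * f y < 0 := by
              by_contra hcon
              have := mul_pos e1 e2
              have h7 : (f x * f a) * (f y * f b) = (f x * f y) * (f a * f b) := by ring
              rw [h7] at this
              have := mul_nonpos_of_nonneg_of_nonpos (not_lt.1 hcon) hfab
              linarith
            have e4 : (x - z) * (y - z) < 0 :=
              mul_neg_of_neg_of_pos (by linarith [hzxy.1]) (by linarith [hzxy.2])
            have := mul_pos_of_neg_of_neg e3 e4
            linarith [show f x * f y * ((x - z) * (y - z)) = f x * (x - z) * (f y * (y - z)) by ring]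
          · have e3 : 0 < f x * f y := by
              apply h x y hxy hx hy
              intro w hw
              rcases Finset.mem_insert.1 hw with rfl | hw
              · rintro ⟨h1, h2⟩
                exact hzxy ⟨lt_of_le_of_ne h1 (hne x hx), lt_of_le_of_ne h2 (hne y hy).symm⟩
              · exact hZxy w hw
            have e4 : 0 < (x - z) * (y - z) := by
              rcases lt_or_gt_of_ne (hne x hx) with h1 | h1
              · have h2 : y < z := by
                  rcases lt_or_gt_of_ne (hne y hy) with h2 | h2
                  · exact h2
                  · exact absurd ⟨h1, h2⟩ hzxy
                exact mul_pos_of_neg_of_neg (by linarith) (by linarith)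
              · exact mul_pos (by linarith) (by linarith)
            have := mul_pos e3 e4
            linarith [show f x * f y * ((x - z) * (y - z)) = f x * (x - z) * (f y * (y - z)) by ring])
      have hzS : z ∉ S := fun hmem => hz (hS hmem)
      refine ⟨insert z S, Finset.insert_subset_insert _ hS, ?_⟩
      intro x y hxy hx hy
      have := hS' x y hxy hx hy
      rw [Finset.prod_insert hzS, Finset.prod_insert hzS]
      simpa [mul_assoc] using this

/-- Rolle at infinity. -/
lemma aux_rolle_infty (f f' : ℝ → ℝ) (hd : ∀ x, HasDerivAt f (f' x) x) (M : ℝ) (hM : f M = 0)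
    (hlim : Tendsto f atTop (𝓝 0)) : ∃ r, M < r ∧ f' r = 0 := by
  by_contra hcon
  push Not at hcon
  have hc : Continuous f := continuous_iff_continuousAt.2 fun y => (hd y).continuousAt
  have key : ∀ g : ℝ → ℝ, Continuous g → g M = 0 → Tendsto g atTop (𝓝 0) →
      (∀ x ∈ Ioi M, 0 < deriv g x) → False := by
    intro g hg hgM hgl hpos
    have hmono := strictMonoOn_of_deriv_pos (convex_Ici M) hg.continuousOn
      (by rwa [interior_Ici])
    have h1 : 0 < g (M + 1) := by
      rw [← hgM]
      exact hmono self_mem_Ici (by simp) (by linarith)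
    have : g (M + 1) ≤ 0 := by
      refine ge_of_tendsto hgl ?_
      filter_upwards [eventually_ge_atTop (M + 1)] with y hy
      exact hmono.monotoneOn (by simp) (show M ≤ y by linarith) hy
    linarith
  rcases hasDerivWithinAt_forall_lt_or_forall_gt_of_forall_ne (convex_Ioi M)
    (fun x _ => (hd x).hasDerivWithinAt) (m := 0) (fun x hx => hcon x hx) with h | h
  · refine key (fun x => - f x) hc.neg (by simp [hM]) (by simpa using hlim.neg) ?_
    intro x hx
    rw [(hd x).fun_neg.deriv]
    linarith [h x hx]
  · refine key f hc hM hlim ?_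
    intro x hx
    rw [(hd x).deriv]
    exact h x hx

lemma aux_main (V : Polynomial ℝ) (hEven : Even V.natDegree) (hdeg : 2 ≤ V.natDegree)
    (hlc : 0 < V.leadingCoeff) (k : ℕ) (hk : 1 ≤ k) (q : Polynomial ℝ) (hq0 : q ≠ 0)
    (hqdeg : q.degree < (2 * k : ℕ))
    (hmom : ∀ g : Polynomial ℝ, g.degree < (2 * k : ℕ) →
      ∫ y : ℝ, auxPhi V q y * (g.eval y * Real.exp (-V.eval y)) = 0) : False := by
  have hI := fun f => aux_integrable V f hEven hdeg hlc
  have hd := auxPhi_hasDerivAt V q (hI q)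
  have hc : Continuous (auxPhi V q) :=
    continuous_iff_continuousAt.2 fun y => (hd y).continuousAt
  have hroot : ∀ r, -2 * (q.eval r * Real.exp (-V.eval r)) = 0 → r ∈ q.roots.toFinset := by
    intro r hr
    have : q.eval r = 0 := by simpa using hr
    simpa [hq0] using this
  have hrcard : q.roots.toFinset.card + 1 ≤ 2 * k := by
    have h1 := q.roots.toFinset_card_le
    have h2 := q.card_roots'
    have h3 : q.natDegree < 2 * k := (natDegree_lt_iff_degree_lt hq0).2 hqdeg
    omega
  have hrolle : ∀ x y, auxPhi V q x = 0 → auxPhi V q y = 0 → x < y →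
      ∃ z ∈ q.roots.toFinset, x < z ∧ z < y := by
    intro x y hx hy hxy
    obtain ⟨z, hz, hz'⟩ := exists_hasDerivAt_eq_zero hxy hc.continuousOn (hx.trans hy.symm)
      (fun z _ => hd z)
    exact ⟨z, hroot z hz', hz.1, hz.2⟩
  have hfin : {x | auxPhi V q x = 0}.Finite := by
    by_contra hinf
    obtain ⟨t, ht, htc⟩ := Set.Infinite.exists_subset_card_eq hinf (2 * k + 1)
    have := Finset.card_le_of_interleaved (s := t) (t := q.roots.toFinset)
      (fun x hx y hy hxy _ => hrolle x y (ht hx) (ht hy) hxy)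
    omega
  set E : Finset ℝ := hfin.toFinset with hE
  have hmemE : ∀ x, x ∈ E ↔ auxPhi V q x = 0 := by intro x; simp [hE]
  have hEcard : E.card ≤ 2 * k := by
    have := Finset.card_le_of_interleaved (s := E) (t := q.roots.toFinset)
      (fun x hx y hy hxy _ => hrolle x y ((hmemE x).1 hx) ((hmemE y).1 hy) hxy)
    omega
  obtain ⟨S, hSE, hS⟩ := aux_signs E E (auxPhi V q) (fun x hx => fun h => hx ((hmemE x).2 h))
    subset_rfl (by
      intro x y hxy hx hy hno
      by_contra hcon
      have h0 : (0:ℝ) ∈ uIcc (auxPhi V q x) (auxPhi V q y) := by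
        rw [mem_uIcc]
        rcases mul_nonpos_iff.1 (not_lt.1 hcon) with h | h
        · right; exact ⟨h.2, h.1⟩
        · left; exact h
      obtain ⟨z, hz, hz0⟩ := intermediate_value_uIcc hc.continuousOn h0
      rw [uIcc_of_le hxy.le] at hz
      exact hno z ((hmemE z).2 hz0) hz)
  set P : Polynomial ℝ := ∏ s ∈ S, (X - C s) with hP
  have hPeval : ∀ x, P.eval x = ∏ s ∈ S, (x - s) := by
    intro x; simp [hP, eval_prod]
  have hPdeg : P.degree = S.card := by
    simp [hP, degree_prod]
  -- case 1: few sign changes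
  have hScard : 2 * k ≤ S.card := by
    by_contra hlt
    have h0 := hmom P (by rw [hPdeg]; exact_mod_cast (not_le.1 hlt))
    obtain ⟨x0, hx0⟩ := E.exists_notMem
    have hx0S : ∀ s ∈ S, x0 - s ≠ 0 := fun s hs h =>
      hx0 (by rw [sub_eq_zero.1 h]; exact hSE hs)
    set A : ℝ := auxPhi V q x0 * P.eval x0 with hA
    have hA0 : A ≠ 0 := by
      refine mul_ne_zero (fun h => hx0 ((hmemE _).2 h)) ?_
      rw [hPeval]; exact Finset.prod_ne_zero_iff.2 hx0S
    have hnn : ∀ y, 0 ≤ A * (auxPhi V q y * P.eval y) := by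
      intro y
      by_cases hy : y ∈ E
      · rw [(hmemE y).1 hy]; simp
      · rcases lt_trichotomy x0 y with h | h | h
        · have := hS x0 y h hx0 hy
          rw [← hPeval, ← hPeval] at this
          exact this.le
        · rw [← h]; exact mul_self_nonneg _
        · have := hS y x0 h hy hx0
          rw [← hPeval, ← hPeval, mul_comm] at this
          exact this.le
    have hpos : 0 < ∫ y, A * (auxPhi V q y * (P.eval y * Real.exp (-V.eval y))) := by
      refine integral_pos_of_integrable_nonneg_nonzero (x := x0) (by fun_prop)
        ((auxPhi_mul_integrable V q P (hI q) (hI P)).const_mul A) ?_ ?_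
      · intro y
        have := mul_nonneg (hnn y) (Real.exp_pos (-V.eval y)).le
        simp only [Pi.zero_apply]
        linarith [show A * (auxPhi V q y * P.eval y) * Real.exp (-V.eval y) =
          A * (auxPhi V q y * (P.eval y * Real.exp (-V.eval y))) by ring]
      · rw [← mul_assoc (auxPhi V q x0), ← hA]
        exact mul_ne_zero hA0 (mul_ne_zero hA0 (Real.exp_pos _).ne')
    rw [integral_const_mul, h0] at hpos
    simp at hpos
  have hSeq : S = E := Finset.eq_of_subset_of_card_le hSE (hEcard.trans hScard)
  have hEc : E.card = 2 * k := le_antisymm hEcard (hSeq ▸ hScard)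
  have hEne : E.Nonempty := Finset.card_pos.1 (by omega)
  -- the total integral vanishes
  have hPtop : ∀ x, (∀ e ∈ E, e < x) → 0 < ∏ s ∈ S, (x - s) := by
    intro x hx
    exact Finset.prod_pos fun s hs => by linarith [hx s (hSE hs)]
  have hPbot : ∀ x, (∀ e ∈ E, x < e) → 0 < ∏ s ∈ S, (x - s) := by
    intro x hx
    have : ∏ s ∈ S, (x - s) = ∏ s ∈ S, (s - x) := by
      have h1 : ∀ s ∈ S, x - s = (-1) * (s - x) := fun s _ => by ring
      rw [Finset.prod_congr rfl h1, Finset.prod_mul_distrib, Finset.prod_const, hSeq, hEc]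
      simp
    rw [this]
    exact Finset.prod_pos fun s hs => by linarith [hx s (hSE hs)]
  have hsgn : ∀ x y, (∀ e ∈ E, x < e) → (∀ e ∈ E, e < y) → 0 < auxPhi V q x * auxPhi V q y := by
    intro x y hx hy
    obtain ⟨e, he⟩ := hEne
    have h1 := hS x y ((hx e he).trans (hy e he)) (fun h => lt_irrefl _ (hx x h))
      (fun h => lt_irrefl _ (hy y h))
    have h2 := mul_pos (hPbot x hx) (hPtop y hy)
    rw [show auxPhi V q x * ∏ s ∈ S, (x - s) = auxPhi V q x * (∏ s ∈ S, (x - s)) from rfl,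
      mul_mul_mul_comm] at h1
    exact (pos_iff_pos_of_mul_pos h1).2 h2
  have hbot := auxPhi_atBot V q (hI q)
  have htop := auxPhi_atTop V q (hI q)
  set c : ℝ := ∫ x : ℝ, q.eval x * Real.exp (-V.eval x) with hcdef
  have hc0 : c = 0 := by
    have hprod : Tendsto (fun x => auxPhi V q (-x) * auxPhi V q x) atTop (𝓝 (c * -c)) :=
      (hbot.comp tendsto_neg_atTop_atBot).mul htop
    have hge : 0 ≤ c * -c := by
      refine ge_of_tendsto hprod ?_
      filter_upwards [eventually_gt_atTop (E.max' hEne), eventually_gt_atTop (-E.min' hEne)]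
        with x hx1 hx2
      refine (hsgn _ _ (fun e he => ?_) (fun e he => ?_)).le
      · have := E.min'_le e he
        linarith
      · exact (E.le_max' e he).trans_lt hx1
    nlinarith
  rw [hc0, neg_zero] at htop
  obtain ⟨r, hr1, hr2⟩ := aux_rolle_infty _ _ hd (E.max' hEne)
    ((hmemE _).1 (E.max'_mem hEne)) htop
  have := Finset.card_le_of_interleaved (s := E) (t := q.roots.toFinset.erase r)
      (fun x hx y hy hxy _ => by
        obtain ⟨z, hz, hz1, hz2⟩ := hrolle x y ((hmemE x).1 hx) ((hmemE y).1 hy) hxy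
        refine ⟨z, Finset.mem_erase.2 ⟨?_, hz⟩, hz1, hz2⟩
        rintro rfl
        linarith [E.le_max' y hy])
  rw [Finset.card_erase_of_mem (hroot r hr2)] at this
  have := Finset.card_pos.2 ⟨r, hroot r hr2⟩
  omega

end Aux

/-- Let `2k ≥ d` and `0 ≤ m ≤ d−2`. If `q ≠ 0` has degree at most `2k−1`,
`⟨q, x^j⟩₂ = 0` for all `0 ≤ j ≤ 2k−d`, and `⟨q, y^n⟩₁ = 0` for all `0 ≤ n ≤ d−2`
with `n ≠ m`, then `⟨q, y^m⟩₁ ≠ 0`. -/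
theorem remaining_pairing_nonzero
    (V : Polynomial ℝ) (hEven : Even V.natDegree) (hdeg : 2 ≤ V.natDegree)
    (hlc : 0 < V.leadingCoeff) (k : ℕ) (hk : V.natDegree ≤ 2 * k)
    (m : ℕ) (hm : m + 2 ≤ V.natDegree)
    (q : Polynomial ℝ) (hq0 : q ≠ 0) (hqdeg : q.degree < (2 * k : ℕ))
    (h2 : ∀ j : ℕ, j + V.natDegree ≤ 2 * k → innerTwo V q (X ^ j) = 0)
    (h1 : ∀ n : ℕ, n + 2 ≤ V.natDegree → n ≠ m → skewInner V q (X ^ n) = 0) :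
    skewInner V q (X ^ m) ≠ 0 := by
  intro hcon
  have h1' : ∀ n : ℕ, n + 2 ≤ V.natDegree → skewInner V q (X ^ n) = 0 := by
    intro n hn
    by_cases h : n = m
    · rw [h]; exact hcon
    · exact h1 n hn h
  exact aux_main V hEven hdeg hlc k (by omega) q hq0 hqdeg
    (aux_moments V hEven hdeg hlc k q h2 h1' (2 * k) le_rfl)
end
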